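/- Let R be an affine UFD over k and B = R[x_0,x_1,x_2] ≅ R^[3]. Then every nontrivial fundamental pair (D,U) of locally nilpotent R-derivations of B is equivalent over R (i.e., conjugate by an R-algebra automorphism of B, up to the symmetry swapping D and U and scaling by a unit) to either (x_0∂_{x_1}, x_1∂_{x_0}) or (x_0∂_{x_1} + x_1∂_{x_2}, 2x_1∂_{x_0} + 2x_2∂_{x_1}). -/

import Mathlib

/-- A derivation is locally nilpotent if every element is annihilated by some power. -/
def IsLND {R B : Type*} [CommRing R] [CommRing B] [Algebra R B]
    (D : Derivation R B B) : Prop :=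
  ∀ b : B, ∃ n : ℕ, (D.toLinearMap ^ n) b = 0

/-- The degree-`d` piece `B_d = ker([D,U] - d·id)` of the `ℤ`-grading induced by `(D, U)`. -/
def gradePiece {R B : Type*} [CommRing R] [CommRing B] [Algebra R B]
    (D U : Derivation R B B) (d : ℤ) : Submodule R B :=
  LinearMap.ker ((⁅D, U⁆ : Derivation R B B).toLinearMap
    - d • (LinearMap.id : B →ₗ[R] B))

/-- `(D, U)` is a fundamental pair: both are locally nilpotent, `[D,[D,U]] = -2D`,
`[U,[D,U]] = 2U`, and `B` is the sum of the eigenspaces of `[D,U]`. -/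
def IsFundamentalPair {R B : Type*} [CommRing R] [CommRing B] [Algebra R B]
    (D U : Derivation R B B) : Prop :=
  IsLND D ∧ IsLND U ∧
    ⁅D, ⁅D, U⁆⁆ = (-2 : ℤ) • D ∧
    ⁅U, ⁅D, U⁆⁆ = (2 : ℤ) • U ∧
    (⨆ d : ℤ, gradePiece D U d) = ⊤

open MvPolynomial

/-- Two pairs of derivations are equivalent if they are conjugate by an algebra
automorphism, up to the symmetry swapping the pair and scaling by a unit. -/
def EquivPair {R B : Type*} [CommRing R] [CommRing B] [Algebra R B]
    (D U D' U' : Derivation R B B) : Prop :=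
  ∃ (α : B ≃ₐ[R] B) (r : Bˣ),
    ((∀ b : B, α (D b) = (r : B) • D' (α b)) ∧
     (∀ b : B, α (U b) = ((r⁻¹ : Bˣ) : B) • U' (α b))) ∨
    ((∀ b : B, α (D b) = (r : B) • U' (α b)) ∧
     (∀ b : B, α (U b) = ((r⁻¹ : Bˣ) : B) • D' (α b)))

local notation "B₃(" R ")" => MvPolynomial (Fin 3) R

/-- An integrable representation of `sl₂` on a vector space: `d` and `u` are locally nilpotent,
`e = [d, u]` is the semisimple element and acts diagonalizably with integral weights. -/
structure IsIntegrableSl2 {F M : Type*} [Field F] [AddCommGroup M] [Module F M]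
    (d u e : Module.End F M) : Prop where
  du : ∀ x, d (u x) = u (d x) + e x
  ed : ∀ x, e (d x) = d (e x) + (2 : F) • d x
  eu : ∀ x, e (u x) = u (e x) - (2 : F) • u x
  dnil : ∀ x, ∃ n : ℕ, (d ^ n) x = 0
  unil : ∀ x, ∃ n : ℕ, (u ^ n) x = 0
  span : ∀ x, x ∈ Submodule.span F {y | ∃ i : ℤ, e y = (i : F) • y}

namespace IsIntegrableSl2

variable {F M : Type*} [Field F] [AddCommGroup M] [Module F M] {d u e : Module.End F M}

lemma e_upow (h : IsIntegrableSl2 d u e) {x : M} {c : F} (hx : e x = c • x) (n : ℕ) :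
    e ((u ^ n) x) = (c - 2 * n) • (u ^ n) x := by
  induction n with
  | zero => simp [hx]
  | succ n ih =>
    rw [pow_succ', Module.End.mul_apply, h.eu, ih, map_smul]
    push_cast
    module

lemma e_dpow (h : IsIntegrableSl2 d u e) {x : M} {c : F} (hx : e x = c • x) (n : ℕ) :
    e ((d ^ n) x) = (c + 2 * n) • (d ^ n) x := by
  induction n with
  | zero => simp [hx]
  | succ n ih =>
    rw [pow_succ', Module.End.mul_apply, h.ed, ih, map_smul]
    push_cast
    module

lemma d_upow (h : IsIntegrableSl2 d u e) {x : M} {c : F} (hx : e x = c • x) (n : ℕ) :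
    d ((u ^ (n + 1)) x) = (u ^ (n + 1)) (d x) + ((n + 1) * (c - n)) • (u ^ n) x := by
  induction n with
  | zero => simp [h.du, hx]
  | succ n ih =>
    rw [pow_succ' u (n + 1), Module.End.mul_apply, h.du, ih, h.e_upow hx]
    rw [map_add, map_smul, ← Module.End.mul_apply u, ← Module.End.mul_apply u, ← pow_succ',
      ← pow_succ']
    push_cast
    module

lemma dpow_u (h : IsIntegrableSl2 d u e) {x : M} {c : F} (hx : e x = c • x) (n : ℕ) :
    (d ^ (n + 1)) (u x) = u ((d ^ (n + 1)) x) + ((n + 1) * (c + n)) • (d ^ n) x := by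
  induction n with
  | zero => simp [h.du, hx]
  | succ n ih =>
    rw [pow_succ' d (n + 1), Module.End.mul_apply, ih, map_add, map_smul, h.du, h.e_dpow hx]
    rw [← Module.End.mul_apply d, ← Module.End.mul_apply d, ← pow_succ', ← pow_succ']
    push_cast
    module

/-- `d ^ N` is injective on vectors of weight at most `-N`. -/
lemma eq_zero_of_dpow [CharZero F] (h : IsIntegrableSl2 d u e) (N : ℕ) :
    ∀ (x : M) (c : ℤ), e x = (c : F) • x → (d ^ N) x = 0 → (N : ℤ) ≤ -c → x = 0 := by
  induction N with
  | zero => intro x c _ h0 _; simpa using h0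
  | succ N ih =>
    intro x c hx hN hc
    set κ : F := N * (c + N + 1) with hκ
    have hdx : e (d x) = (c + 2 : F) • d x := by
      simpa using h.e_dpow hx 1
    have hz : u (d x) - κ • x = 0 := by
      refine ih _ c ?_ ?_ (by push_cast at hc; lia)
      · rw [map_sub, h.eu, hdx, map_smul, map_smul, hx]; module
      · rw [map_sub, map_smul]
        cases N with
        | zero => simp at hN; simp [hN, hκ]
        | succ N =>
          have e1 : (d ^ (N + 1)) (d x) = 0 := by rw [← Module.End.mul_apply, ← pow_succ, hN]
          have e2 : (d ^ N) (d x) = (d ^ (N + 1)) x := by rw [pow_succ]; rfl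
          rw [h.dpow_u hdx, e1, map_zero, e2, hκ]
          push_cast
          module
    have hud : u (d x) = κ • x := sub_eq_zero.mp hz
    have key : ∀ k : ℕ, (u ^ k) x = 0 → x = 0 := by
      intro k
      induction k with
      | zero => intro h0; simpa using h0
      | succ k ihk =>
        intro h0
        apply ihk
        have h1 := h.d_upow hx k
        rw [h0, map_zero, pow_succ u k, Module.End.mul_apply, hud, map_smul, ← add_smul] at h1
        refine (smul_eq_zero.mp h1.symm).resolve_left ?_
        have h2 : κ + (k + 1) * (c - k) = ((N + k + 1 : ℤ) * (c + N - k) : ℤ) := by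
          rw [hκ]; push_cast; ring
        rw [h2]
        refine Int.cast_ne_zero.mpr ?_
        push_cast at hc
        exact mul_ne_zero (by lia) (by lia)
    obtain ⟨k, hk⟩ := h.unil x
    exact key k hk

lemma eq_zero_of_neg [CharZero F] (h : IsIntegrableSl2 d u e) {a : M} {c : ℤ}
    (ha : d a = 0) (hc : e a = (c : F) • a) (hneg : c < 0) : a = 0 :=
  h.eq_zero_of_dpow 1 a c hc (by simpa using ha) (by push_cast; lia)

lemma u_eq_zero [CharZero F] (h : IsIntegrableSl2 d u e) {a : M}
    (ha : d a = 0) (hc : e a = 0) : u a = 0 := by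
  refine h.eq_zero_of_neg (c := -2) ?_ ?_ (by norm_num)
  · rw [h.du, ha, hc]; simp
  · rw [h.eu, hc]; push_cast; simp

lemma e_eq_zero (h : IsIntegrableSl2 d u e) {a : M} (ha : d a = 0) (hu : u a = 0) : e a = 0 := by
  simpa [ha, hu] using (h.du a).symm

lemma dpow_upow [CharZero F] (h : IsIntegrableSl2 d u e) {a : M} {c : ℤ}
    (ha : d a = 0) (hc : e a = (c : F) • a) (N : ℕ) (hN : (N : ℤ) ≤ c) :
    ∃ γ : F, γ ≠ 0 ∧ (d ^ N) ((u ^ N) a) = γ • a := by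
  induction N with
  | zero => exact ⟨1, one_ne_zero, by simp⟩
  | succ N ih =>
    push_cast at hN
    obtain ⟨γ, hγ, h1⟩ := ih (by lia)
    refine ⟨(N + 1) * (c - N) * γ, ?_, ?_⟩
    · have : ((N + 1 : ℤ) * (c - N) : ℤ) ≠ 0 := mul_ne_zero (by lia) (by lia)
      have h2 : ((N : F) + 1) * (c - N) ≠ 0 := by exact_mod_cast this
      exact mul_ne_zero h2 hγ
    · rw [pow_succ, Module.End.mul_apply, h.d_upow hc, ha, map_zero, zero_add, map_smul, h1,
        smul_smul]

/-- The vectors `u ^ i a` with `a` a highest weight vector span an integrable representation. -/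
lemma mem_span_strings [CharZero F] (h : IsIntegrableSl2 d u e) (x : M) :
    x ∈ Submodule.span F
      {y | ∃ (c : ℤ) (i : ℕ) (a : M), d a = 0 ∧ e a = (c : F) • a ∧ y = (u ^ i) a} := by
  set T := Submodule.span F
      {y | ∃ (c : ℤ) (i : ℕ) (a : M), d a = 0 ∧ e a = (c : F) • a ∧ y = (u ^ i) a} with hT
  have key : ∀ (N : ℕ) (x : M) (c : ℤ), e x = (c : F) • x → (d ^ N) x = 0 → x ∈ T := by
    intro N
    induction N with
    | zero => intro x c _ h0; have : x = 0 := by simpa using h0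
              rw [this]; exact T.zero_mem
    | succ N ih =>
      intro x c hx hN
      by_cases hle : ((N + 1 : ℕ) : ℤ) ≤ -c
      · rw [h.eq_zero_of_dpow (N + 1) x c hx hN hle]; exact T.zero_mem
      push_cast at hle
      have ha : d ((d ^ N) x) = 0 := by rw [← Module.End.mul_apply, ← pow_succ', hN]
      have hc : e ((d ^ N) x) = ((c + 2 * N : ℤ) : F) • (d ^ N) x := by
        rw [h.e_dpow hx]; push_cast; rfl
      obtain ⟨γ, hγ, h1⟩ := h.dpow_upow ha hc N (by lia)
      have hmem : (u ^ N) ((d ^ N) x) ∈ T := Submodule.subset_span ⟨_, N, _, ha, hc, rfl⟩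
      have h2 : x - γ⁻¹ • (u ^ N) ((d ^ N) x) ∈ T := by
        refine ih _ c ?_ ?_
        · rw [map_sub, map_smul, h.e_upow hc, hx]; push_cast; module
        · rw [map_sub, map_smul, h1, smul_smul, inv_mul_cancel₀ hγ, one_smul, sub_self]
      simpa using T.add_mem h2 (T.smul_mem γ⁻¹ hmem)
  refine Submodule.span_le.mpr ?_ (h.span x)
  rintro y ⟨i, hi⟩
  obtain ⟨n, hn⟩ := h.dnil y
  exact key n y i hi hn

/-- Every vector is the sum of an invariant and an element of `d M + u M`. -/
lemma exists_invariant [CharZero F] (h : IsIntegrableSl2 d u e) (x : M) :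
    ∃ y, d y = 0 ∧ u y = 0 ∧ x - y ∈ LinearMap.range d ⊔ LinearMap.range u := by
  set T := LinearMap.range d ⊔ LinearMap.range u
  have := h.mem_span_strings x
  induction this using Submodule.span_induction with
  | mem x hx =>
    obtain ⟨c, i, a, ha, hc, rfl⟩ := hx
    cases i with
    | succ i =>
      refine ⟨0, by simp, by simp, ?_⟩
      rw [sub_zero, pow_succ', Module.End.mul_apply]
      exact Submodule.mem_sup_right ⟨_, rfl⟩
    | zero =>
      by_cases h0 : c = 0
      · have : e a = 0 := by rw [hc, h0]; simp
        exact ⟨a, ha, h.u_eq_zero ha this, by simp⟩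
      · refine ⟨0, by simp, by simp, ?_⟩
        have h1 : d ((c : F)⁻¹ • u a) = a := by
          rw [map_smul, h.du, ha, map_zero, zero_add, hc, smul_smul, inv_mul_cancel₀ (by simpa),
            one_smul]
        exact Submodule.mem_sup_left ⟨(c : F)⁻¹ • u a, by rw [h1]; simp⟩
  | zero => exact ⟨0, by simp⟩
  | add x y _ _ hx hy =>
    obtain ⟨a, h1, h2, h3⟩ := hx
    obtain ⟨b, h4, h5, h6⟩ := hy
    exact ⟨a + b, by simp [h1, h4], by simp [h2, h5], by
      rw [add_sub_add_comm]; exact T.add_mem h3 h6⟩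
  | smul r x _ hx =>
    obtain ⟨a, h1, h2, h3⟩ := hx
    exact ⟨r • a, by simp [h1], by simp [h2], by rw [← smul_sub]; exact T.smul_mem r h3⟩

/-- `d M + u M` contains no nonzero invariant. -/
lemma eq_zero_of_mem_range [CharZero F] (h : IsIntegrableSl2 d u e) {y : M}
    (hd : d y = 0) (hu : u y = 0) (hy : y ∈ LinearMap.range d ⊔ LinearMap.range u) : y = 0 := by
  set C : Module.End F M := (4 : F) • (u * d) + e * e + (2 : F) • e with hC
  have hCu : ∀ x, C (u x) = u (C x) := by
    intro x
    simp only [hC, LinearMap.add_apply, LinearMap.smul_apply, Module.End.mul_apply, map_add,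
      map_smul, h.du, h.eu, map_sub]
    module
  set S : Set M := {y | ∃ (c : ℤ) (i : ℕ) (a : M),
    d a = 0 ∧ e a = (c : F) • a ∧ 0 < c ∧ y = (u ^ i) a} with hS
  have hstr : ∀ (c : ℤ) (i : ℕ) (a : M), d a = 0 → e a = (c : F) • a →
      (u ^ i) a ∈ Submodule.span F S ∨ (d ((u ^ i) a) = 0 ∧ u ((u ^ i) a) = 0) := by
    intro c i a ha hc
    rcases lt_trichotomy c 0 with h0 | h0 | h0
    · right; simp [h.eq_zero_of_neg ha hc h0]
    · right
      have hua := h.u_eq_zero ha (by rw [hc, h0]; simp)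
      cases i with
      | zero => simp [ha, hua]
      | succ i => simp [pow_succ, hua]
    · left; exact Submodule.subset_span ⟨c, i, a, ha, hc, h0, rfl⟩
  have hdS : ∀ x ∈ Submodule.span F S, d x ∈ Submodule.span F S := by
    intro x hx
    induction hx using Submodule.span_induction with
    | mem x hx =>
      obtain ⟨c, i, a, ha, hc, h0, rfl⟩ := hx
      cases i with
      | zero => simp [ha]
      | succ i =>
        rw [h.d_upow hc, ha, map_zero, zero_add]
        exact Submodule.smul_mem _ _ (Submodule.subset_span ⟨c, i, a, ha, hc, h0, rfl⟩)
    | zero => simp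
    | add x y _ _ hx hy => rw [map_add]; exact add_mem hx hy
    | smul r x _ hx => rw [map_smul]; exact Submodule.smul_mem _ _ hx
  have huS : ∀ x ∈ Submodule.span F S, u x ∈ Submodule.span F S := by
    intro x hx
    induction hx using Submodule.span_induction with
    | mem x hx =>
      obtain ⟨c, i, a, ha, hc, h0, rfl⟩ := hx
      exact Submodule.subset_span ⟨c, i + 1, a, ha, hc, h0, by
        rw [pow_succ', Module.End.mul_apply]⟩
    | zero => simp
    | add x y _ _ hx hy => rw [map_add]; exact add_mem hx hy
    | smul r x _ hx => rw [map_smul]; exact Submodule.smul_mem _ _ hx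
  have hdu : ∀ x, d x ∈ Submodule.span F S ∧ u x ∈ Submodule.span F S := by
    intro x
    have := h.mem_span_strings x
    induction this using Submodule.span_induction with
    | mem x hx =>
      obtain ⟨c, i, a, ha, hc, rfl⟩ := hx
      rcases hstr c i a ha hc with h1 | h1
      · exact ⟨hdS _ h1, huS _ h1⟩
      · simp [h1.1, h1.2]
    | zero => simp
    | add x y _ _ hx hy =>
      simp only [map_add]; exact ⟨add_mem hx.1 hy.1, add_mem hx.2 hy.2⟩
    | smul r x _ hx =>
      simp only [map_smul]
      exact ⟨Submodule.smul_mem _ _ hx.1, Submodule.smul_mem _ _ hx.2⟩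
  have hyS : y ∈ Submodule.span F S := by
    refine (sup_le ?_ ?_ : LinearMap.range d ⊔ LinearMap.range u ≤ _) hy
    · rintro _ ⟨x, rfl⟩; exact (hdu x).1
    · rintro _ ⟨x, rfl⟩; exact (hdu x).2
  have hχ : ∃ χ : Polynomial F, χ.eval 0 ≠ 0 ∧ Polynomial.aeval C χ y = 0 := by
    clear hd hu hy
    induction hyS using Submodule.span_induction with
    | mem x hx =>
      obtain ⟨c, i, a, ha, hc, h0, rfl⟩ := hx
      have hCa : C a = ((c : F) * (c + 2)) • a := by
        simp only [hC, LinearMap.add_apply, LinearMap.smul_apply, Module.End.mul_apply, ha, hc,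
          map_zero, map_smul]
        module
      have hCi : C ((u ^ i) a) = ((c : F) * (c + 2)) • (u ^ i) a := by
        induction i with
        | zero => simpa using hCa
        | succ i ih => rw [pow_succ', Module.End.mul_apply, hCu, ih, map_smul]
      refine ⟨Polynomial.X - Polynomial.C ((c : F) * (c + 2)), ?_, ?_⟩
      · have : (c * (c + 2) : ℤ) ≠ 0 := mul_ne_zero (by lia) (by lia)
        have h2 : (c : F) * (c + 2) ≠ 0 := by exact_mod_cast this
        simpa using h2
      · rw [map_sub, Polynomial.aeval_X, Polynomial.aeval_C, LinearMap.sub_apply, hCi,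
          Module.algebraMap_end_apply, sub_self]
    | zero => exact ⟨1, by simp, by simp⟩
    | add x y _ _ hx hy =>
      obtain ⟨p, h1, h2⟩ := hx
      obtain ⟨q, h3, h4⟩ := hy
      refine ⟨p * q, by simpa using ⟨h1, h3⟩, ?_⟩
      rw [map_add, map_mul, Module.End.mul_apply, Module.End.mul_apply, h4, map_zero, add_zero,
        ← Module.End.mul_apply, ← map_mul, mul_comm, map_mul, Module.End.mul_apply, h2, map_zero]
    | smul r x _ hx =>
      obtain ⟨p, h1, h2⟩ := hx
      exact ⟨p, h1, by rw [map_smul, h2, smul_zero]⟩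
  obtain ⟨χ, h1, h2⟩ := hχ
  have hCy : C y = 0 := by
    have hey := h.e_eq_zero hd hu
    simp [hC, hd, hey]
  have h3 : Polynomial.aeval C χ y = χ.eval 0 • y := by
    clear h1 h2
    induction χ using Polynomial.induction_on' with
    | add p q hp hq => simp [hp, hq, add_smul]
    | monomial n a => 
      cases n with
      | zero => simp [Module.algebraMap_end_apply]
      | succ n => simp [Polynomial.aeval_monomial, pow_succ, hCy]
  rw [h3] at h2
  exact (smul_eq_zero.mp h2).resolve_left h1

/-- Every vector is annihilated by a product of operators `e - i` with `i` an integer. -/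
lemma exists_weights (h : IsIntegrableSl2 d u e) (x : M) :
    ∃ s : Multiset ℤ, Polynomial.aeval e
      ((s.map fun i : ℤ => Polynomial.X - Polynomial.C (i : F)).prod) x = 0 := by
  have := h.span x
  induction this using Submodule.span_induction with
  | mem x hx =>
    obtain ⟨i, hi⟩ := hx
    exact ⟨{i}, by simp [hi, Int.cast_smul_eq_zsmul]⟩
  | zero => exact ⟨0, by simp⟩
  | add x y _ _ hx hy =>
    obtain ⟨s, hs⟩ := hx
    obtain ⟨t, ht⟩ := hy
    refine ⟨s + t, ?_⟩
    rw [Multiset.map_add, Multiset.prod_add, map_add, map_mul, Module.End.mul_apply,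
      Module.End.mul_apply, ht, map_zero, add_zero,
      ← Module.End.mul_apply, ← map_mul, mul_comm, map_mul, Module.End.mul_apply, hs, map_zero]
  | smul r x _ hx =>
    obtain ⟨s, hs⟩ := hx
    exact ⟨s, by rw [map_smul, hs, smul_zero]⟩

end IsIntegrableSl2

namespace Derivation

section Iterate

variable {R B : Type*} [CommRing R] [CommRing B] [Algebra R B] (D : Derivation R B B)

lemma iterate_mul_of_iterate_eq_zero (N : ℕ) : ∀ (m n : ℕ) (a b : B), m + n = N →
    D^[m + 1] a = 0 → D^[n + 1] b = 0 →
    D^[N + 1] (a * b) = 0 ∧ ∃ c : ℕ, c ≠ 0 ∧ D^[N] (a * b) = c * (D^[m] a * D^[n] b) := by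
  induction N with
  | zero =>
    intro m n a b hmn ha hb
    obtain ⟨rfl, rfl⟩ : m = 0 ∧ n = 0 := by lia
    simp only [zero_add, Function.iterate_one, Function.iterate_zero, id] at *
    exact ⟨by simp [ha, hb], 1, one_ne_zero, by simp⟩
  | succ N ih =>
    intro m n a b hmn ha hb
    have key : ∀ (m n : ℕ) (a b : B), m + n = N + 1 → D^[m + 1] a = 0 → D^[n + 1] b = 0 →
        D^[N + 1] (a * D b) = 0 ∧ ∃ c : ℕ, (n ≠ 0 → c ≠ 0) ∧
          D^[N] (a * D b) = c * (D^[m] a * D^[n] b) := by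
      intro m n a b hmn ha hb
      cases n with
      | zero =>
        have : D b = 0 := by simpa using hb
        rw [this, mul_zero, iterate_map_zero, iterate_map_zero]
        exact ⟨rfl, 0, by simp, by simp⟩
      | succ n =>
        obtain ⟨h1, c, hc, h2⟩ := ih m n a (D b) (by lia) ha (by simpa using hb)
        exact ⟨h1, c, fun _ => hc, by rw [h2, Function.iterate_succ_apply]⟩
    obtain ⟨h1, c, hc, h2⟩ := key m n a b hmn ha hb
    obtain ⟨h3, c', hc', h4⟩ := key n m b a (by lia) hb ha
    rw [Function.iterate_succ_apply D (N + 1), Function.iterate_succ_apply D N (a * b), leibniz,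
      smul_eq_mul,
      smul_eq_mul, iterate_map_add, h1, h3, iterate_map_add, h2, h4]
    refine ⟨by simp, c + c', ?_, by push_cast; ring⟩
    rcases Nat.eq_zero_or_pos n with h | h
    · have := hc' (by lia); lia
    · have := hc (by lia); lia

variable {D}

lemma exists_last_iterate (hD : ∀ b, ∃ n : ℕ, D^[n] b = 0) {a : B} (ha : a ≠ 0) :
    ∃ m : ℕ, D^[m] a ≠ 0 ∧ D^[m + 1] a = 0 := by
  classical
  have h := Nat.find_spec (hD a)
  have hpos : Nat.find (hD a) ≠ 0 := by
    intro h0; rw [h0] at h; exact ha h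
  refine ⟨Nat.find (hD a) - 1, Nat.find_min (hD a) (by lia), ?_⟩
  rwa [Nat.sub_add_cancel (by lia)]

variable [IsDomain B] [CharZero B]

/-- The kernel of a locally nilpotent derivation of a domain is factorially closed. -/
lemma eq_zero_of_map_mul (hD : ∀ b, ∃ n : ℕ, D^[n] b = 0) {a b : B} (hab : a * b ≠ 0)
    (h : D (a * b) = 0) : D a = 0 := by
  obtain ⟨m, hm, hm'⟩ := exists_last_iterate hD (left_ne_zero_of_mul hab)
  obtain ⟨n, hn, hn'⟩ := exists_last_iterate hD (right_ne_zero_of_mul hab)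
  obtain ⟨-, c, hc, h2⟩ := D.iterate_mul_of_iterate_eq_zero _ m n a b rfl hm' hn'
  rcases Nat.eq_zero_or_pos m with rfl | hpos
  · simpa using hm'
  · exfalso
    obtain ⟨l, rfl⟩ := Nat.exists_eq_succ_of_ne_zero hpos.ne'
    rw [show l.succ + n = (l + n) + 1 by lia, Function.iterate_succ_apply, h,
      iterate_map_zero] at h2
    exact mul_ne_zero (Nat.cast_ne_zero.mpr hc) (mul_ne_zero hm hn) h2.symm

/-- An element dividing its image under a locally nilpotent derivation is a constant. -/
lemma eq_zero_of_dvd_map (hD : ∀ b, ∃ n : ℕ, D^[n] b = 0) {p : B} (h : p ∣ D p) : D p = 0 := by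
  by_contra h0
  obtain ⟨c, hc⟩ := h
  have hp : p ≠ 0 := by rintro rfl; simp at h0
  have hc0 : c ≠ 0 := by rintro rfl; simp [hc] at h0
  obtain ⟨m, hm, hm'⟩ := exists_last_iterate hD hp
  obtain ⟨n, hn, hn'⟩ := exists_last_iterate hD hc0
  obtain ⟨-, r, hr, h2⟩ := D.iterate_mul_of_iterate_eq_zero _ m n p c rfl hm' hn'
  have : D^[m + n] (p * c) = 0 := by
    rw [← hc, ← Function.iterate_succ_apply, show (m + n).succ = n + (m + 1) by lia,
      Function.iterate_add_apply, hm', iterate_map_zero]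
  rw [this] at h2
  exact mul_ne_zero (Nat.cast_ne_zero.mpr hr) (mul_ne_zero hm hn) h2.symm

end Iterate

end Derivation

/-- Derivations `D, U, E` over `R` of a `k`-algebra forming an integrable `sl₂`-triple. -/
def IsSl2Action {R B : Type*} (k : Type*) [Field k] [CommRing R] [CommRing B] [Algebra R B]
    [Algebra k R] [Algebra k B] [IsScalarTower k R B] (D U E : Derivation R B B) : Prop :=
  IsIntegrableSl2 (F := k) (D.toLinearMap.restrictScalars k) (U.toLinearMap.restrictScalars k)
    (E.toLinearMap.restrictScalars k)

namespace IsSl2Action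

variable {k R B : Type*} [Field k] [CommRing R] [CommRing B] [Algebra R B]
    [Algebra k R] [Algebra k B] [IsScalarTower k R B] {D U E : Derivation R B B}

lemma pow_restrictScalars_apply (D : Derivation R B B) (n : ℕ) (b : B) :
    ((D.toLinearMap.restrictScalars k : Module.End k B) ^ n) b = D^[n] b := by
  rw [Module.End.pow_apply]; rfl

lemma intCast_smul (c : ℤ) (b : B) : (c : k) • b = (c : B) * b := by
  rw [Algebra.smul_def, map_intCast]

lemma du (h : IsSl2Action k D U E) (x : B) : D (U x) = U (D x) + E x := IsIntegrableSl2.du h x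

lemma ed (h : IsSl2Action k D U E) (x : B) : E (D x) = D (E x) + 2 * D x := by
  have := IsIntegrableSl2.ed h x
  rw [Algebra.smul_def, map_ofNat] at this
  exact this

lemma eu (h : IsSl2Action k D U E) (x : B) : E (U x) = U (E x) - 2 * U x := by
  have := IsIntegrableSl2.eu h x
  rw [Algebra.smul_def, map_ofNat] at this
  exact this

lemma lnd_d (h : IsSl2Action k D U E) (x : B) : ∃ n : ℕ, D^[n] x = 0 := by
  obtain ⟨n, hn⟩ := IsIntegrableSl2.dnil h x
  exact ⟨n, by rwa [pow_restrictScalars_apply] at hn⟩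

lemma lnd_u (h : IsSl2Action k D U E) (x : B) : ∃ n : ℕ, U^[n] x = 0 := by
  obtain ⟨n, hn⟩ := IsIntegrableSl2.unil h x
  exact ⟨n, by rwa [pow_restrictScalars_apply] at hn⟩

lemma e_iterate_u (h : IsSl2Action k D U E) {x : B} {c : ℤ} (hx : E x = c * x) (n : ℕ) :
    E (U^[n] x) = ((c - 2 * n : ℤ) : B) * U^[n] x := by
  induction n with
  | zero => simpa using hx
  | succ n ih =>
    have h1 := U.leibniz ((c - 2 * n : ℤ) : B) (U^[n] x)
    rw [Derivation.map_intCast] at h1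
    rw [Function.iterate_succ_apply', h.eu, ih, h1]
    push_cast
    simp only [smul_eq_mul]
    ring

lemma d_iterate_u (h : IsSl2Action k D U E) {x : B} {c : ℤ} (hx : E x = c * x) (hd : D x = 0)
    (n : ℕ) : D (U^[n + 1] x) = (((n + 1) * (c - n) : ℤ) : B) * U^[n] x := by
  induction n with
  | zero => simp [h.du, hx, hd]
  | succ n ih =>
    have h1 := U.leibniz (((n + 1) * (c - n) : ℤ) : B) (U^[n] x)
    rw [Derivation.map_intCast] at h1
    rw [Function.iterate_succ_apply', h.du, ih, h1, h.e_iterate_u hx]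
    simp only [smul_eq_mul, Function.iterate_succ_apply']
    push_cast
    ring

variable [CharZero k]

lemma eq_zero_of_neg (h : IsSl2Action k D U E) {a : B} {c : ℤ}
    (ha : D a = 0) (hc : E a = c * a) (hneg : c < 0) : a = 0 :=
  IsIntegrableSl2.eq_zero_of_neg h ha (by rw [intCast_smul]; exact hc) hneg

lemma u_eq_zero (h : IsSl2Action k D U E) {a : B} (ha : D a = 0) (hc : E a = 0) : U a = 0 :=
  IsIntegrableSl2.u_eq_zero h ha hc

omit [CharZero k] in
lemma e_eq_zero (h : IsSl2Action k D U E) {a : B} (ha : D a = 0) (hu : U a = 0) : E a = 0 :=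
  IsIntegrableSl2.e_eq_zero h ha hu

lemma iterate_u_eq_zero (h : IsSl2Action k D U E) {a : B} {c : ℕ} (ha : D a = 0)
    (hc : E a = c * a) : U^[c + 1] a = 0 := by
  have hc' : E a = ((c : ℤ) : B) * a := by simpa using hc
  refine h.eq_zero_of_neg (c := -c - 2) ?_ ?_ (by lia)
  · rw [h.d_iterate_u hc' ha]; simp
  · rw [h.e_iterate_u hc']; push_cast; ring

/-- Every element is a sum of elements `U^i a` with `a` a highest weight vector. -/
lemma string_induction (h : IsSl2Action k D U E) {motive : B → Prop}
    (string : ∀ (c i : ℕ) (a : B), D a = 0 → E a = c * a → motive (U^[i] a))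
    (add : ∀ x y, motive x → motive y → motive (x + y)) (x : B) : motive x := by
  have hx := IsIntegrableSl2.mem_span_strings h x
  suffices ∀ r : k, motive (r • x) by simpa using this 1
  induction hx using Submodule.span_induction with
  | mem x hx =>
    intro r
    obtain ⟨c, i, a, ha, hc, rfl⟩ := hx
    rw [intCast_smul] at hc
    change D a = 0 at ha
    change E a = c * a at hc
    rw [pow_restrictScalars_apply]
    by_cases hneg : c < 0
    · rw [h.eq_zero_of_neg ha hc hneg, iterate_map_zero, smul_zero]
      simpa using string 0 0 0 (by simp) (by simp)
    · obtain ⟨c, rfl⟩ := Int.eq_ofNat_of_zero_le (not_lt.mp hneg)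
      have e : ∀ X : Derivation R B B, ∀ b, X (r • b) = r • X b := fun X b =>
        (X.toLinearMap.restrictScalars k).map_smul r b
      have : r • U^[i] a = U^[i] (r • a) := by
        induction i with
        | zero => rfl
        | succ i ih => rw [Function.iterate_succ_apply', Function.iterate_succ_apply', ← ih, e]
      rw [this]
      refine string c i _ (by rw [e, ha, smul_zero]) ?_
      rw [e, hc]
      simp
  | zero => intro r; simpa using string 0 0 0 (by simp) (by simp)
  | add x y _ _ hx hy => intro r; rw [smul_add]; exact add _ _ (hx r) (hy r)
  | smul s x _ hx => intro r; rw [smul_smul]; exact hx _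

lemma exists_invariant (h : IsSl2Action k D U E) (x : B) :
    ∃ y a b, D y = 0 ∧ U y = 0 ∧ x = y + D a + U b := by
  obtain ⟨y, h1, h2, h3⟩ := IsIntegrableSl2.exists_invariant h x
  obtain ⟨_, ⟨a, rfl⟩, _, ⟨b, rfl⟩, h4⟩ := Submodule.mem_sup.mp h3
  refine ⟨y, a, b, h1, h2, ?_⟩
  rw [add_assoc]
  exact (sub_eq_iff_eq_add'.mp h4.symm)

lemma eq_zero_of_mem_range (h : IsSl2Action k D U E) {y a b : B}
    (hd : D y = 0) (hu : U y = 0) (hy : y = D a + U b) : y = 0 :=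
  IsIntegrableSl2.eq_zero_of_mem_range h hd hu
    (hy ▸ Submodule.add_mem_sup ⟨a, rfl⟩ ⟨b, rfl⟩)

end IsSl2Action

/-- If `f` acts on a trilinear expression by the Leibniz rule through a locally nilpotent map,
then it is nilpotent on its values. -/
lemma iterate_trilinear_eq_zero {B M : Type*} [AddCommGroup B] [AddCommGroup M] (D : B →+ B)
    (f : M →+ M) (T : B → B → B → M) (h1 : ∀ b c, T 0 b c = 0) (h2 : ∀ a c, T a 0 c = 0)
    (h3 : ∀ a b, T a b 0 = 0)
    (hf : ∀ a b c, f (T a b c) = T (D a) b c + T a (D b) c + T a b (D c)) (N : ℕ) :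
    ∀ (i j k : ℕ) (a b c : B), i + j + k ≤ N → D^[i] a = 0 → D^[j] b = 0 → D^[k] c = 0 →
      f^[N] (T a b c) = 0 := by
  induction N with
  | zero =>
    intro i j k a b c hN ha hb hc
    obtain rfl : i = 0 := by lia
    have : a = 0 := ha
    simp [this, h1]
  | succ N ih =>
    intro i j k a b c hN ha hb hc
    cases i with
    | zero => have : a = 0 := ha
              rw [this, h1, iterate_map_zero]
    | succ i =>
      cases j with
      | zero => have : b = 0 := hb
                rw [this, h2, iterate_map_zero]
      | succ j =>
        cases k with
        | zero => have : c = 0 := hc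
                  rw [this, h3, iterate_map_zero]
        | succ k =>
          rw [Function.iterate_succ_apply, hf, iterate_map_add, iterate_map_add,
            ih i (j + 1) (k + 1) _ _ _ (by lia) (by simpa using ha) hb hc,
            ih (i + 1) j (k + 1) _ _ _ (by lia) ha (by simpa using hb) hc,
            ih (i + 1) (j + 1) k _ _ _ (by lia) ha hb (by simpa using hc)]
          simp

namespace MvPolynomial

variable {R : Type*} [CommRing R]

lemma pderiv_comm (i j : Fin 3) (b : B₃(R)) : pderiv i (pderiv j b) = pderiv j (pderiv i b) := by
  have h : ⁅(pderiv i : Derivation R B₃(R) B₃(R)), (pderiv j : Derivation R B₃(R) B₃(R))⁆ = 0 := by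
    apply derivation_ext
    intro l
    rw [Derivation.commutator_apply, pderiv_X, pderiv_X]
    simp [Pi.single_apply, apply_ite]
  have := congrArg (fun X : Derivation R B₃(R) B₃(R) => X b) h
  simpa [Derivation.commutator_apply, sub_eq_zero] using this

lemma derivation_apply_eq (Z : Derivation R B₃(R) B₃(R)) (b : B₃(R)) :
    Z b = Z (X 0) * pderiv 0 b + Z (X 1) * pderiv 1 b + Z (X 2) * pderiv 2 b := by
  have h : Z = Z (X 0) • pderiv 0 + Z (X 1) • pderiv 1 + Z (X 2) • pderiv 2 := by
    apply derivation_ext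
    intro l
    fin_cases l <;> simp [pderiv_X]
  nth_rewrite 1 [h]
  simp

/-- The Jacobian determinant. -/
noncomputable def jac (a b c : B₃(R)) : B₃(R) :=
  pderiv 0 a * (pderiv 1 b * pderiv 2 c - pderiv 2 b * pderiv 1 c) +
  pderiv 1 a * (pderiv 2 b * pderiv 0 c - pderiv 0 b * pderiv 2 c) +
  pderiv 2 a * (pderiv 0 b * pderiv 1 c - pderiv 1 b * pderiv 0 c)

/-- The Jacobian determinant as a derivation in the first argument. -/
noncomputable def jacDer (b c : B₃(R)) : Derivation R B₃(R) B₃(R) :=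
  (pderiv 1 b * pderiv 2 c - pderiv 2 b * pderiv 1 c) • pderiv 0 +
  (pderiv 2 b * pderiv 0 c - pderiv 0 b * pderiv 2 c) • pderiv 1 +
  (pderiv 0 b * pderiv 1 c - pderiv 1 b * pderiv 0 c) • pderiv 2

lemma jacDer_apply (a b c : B₃(R)) : jacDer b c a = jac a b c := by
  simp [jacDer, jac]; ring

lemma jac_rotate (a b c : B₃(R)) : jac a b c = jac b c a := by
  simp only [jac]; ring

lemma jac_swap (a b c : B₃(R)) : jac a c b = -jac a b c := by
  simp only [jac]; ring

lemma jac_X : jac (X 0) (X 1) (X 2 : B₃(R)) = 1 := by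
  simp [jac, pderiv_X]

/-- The divergence of a derivation. -/
noncomputable def divergence (Z : Derivation R B₃(R) B₃(R)) : B₃(R) :=
  pderiv 0 (Z (X 0)) + pderiv 1 (Z (X 1)) + pderiv 2 (Z (X 2))

lemma pderiv_derivation (Z : Derivation R B₃(R) B₃(R)) (i : Fin 3) (b : B₃(R)) :
    pderiv i (Z b) = Z (pderiv i b) + (pderiv i (Z (X 0)) * pderiv 0 b +
      pderiv i (Z (X 1)) * pderiv 1 b + pderiv i (Z (X 2)) * pderiv 2 b) := by
  rw [derivation_apply_eq Z b, derivation_apply_eq Z (pderiv i b)]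
  simp only [map_add, Derivation.leibniz, smul_eq_mul]
  rw [pderiv_comm 0 i, pderiv_comm 1 i, pderiv_comm 2 i]
  ring

lemma derivation_jac (Z : Derivation R B₃(R) B₃(R)) (a b c : B₃(R)) :
    Z (jac a b c) + divergence Z * jac a b c = jac (Z a) b c + jac a (Z b) c + jac a b (Z c) := by
  simp only [jac, pderiv_derivation Z _ a, pderiv_derivation Z _ b, pderiv_derivation Z _ c,
    map_add, map_sub, Derivation.leibniz, smul_eq_mul, divergence]
  ring

lemma divergence_add (Y Z : Derivation R B₃(R) B₃(R)) :
    divergence (Y + Z) = divergence Y + divergence Z := by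
  simp [divergence]; ring

lemma divergence_sub (Y Z : Derivation R B₃(R) B₃(R)) :
    divergence (Y - Z) = divergence Y - divergence Z := by
  simp [divergence]; ring

lemma divergence_smul (b : B₃(R)) (Z : Derivation R B₃(R) B₃(R)) :
    divergence (b • Z) = Z b + b * divergence Z := by
  rw [derivation_apply_eq Z b]
  simp [divergence, Derivation.leibniz]; ring

lemma divergence_lie (Y Z : Derivation R B₃(R) B₃(R)) :
    divergence ⁅Y, Z⁆ = Y (divergence Z) - Z (divergence Y) := by
  simp only [divergence, Derivation.commutator_apply, map_add, map_sub]
  rw [pderiv_derivation Y 0 (Z (X 0)), pderiv_derivation Y 1 (Z (X 1)),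
    pderiv_derivation Y 2 (Z (X 2)), pderiv_derivation Z 0 (Y (X 0)),
    pderiv_derivation Z 1 (Y (X 1)), pderiv_derivation Z 2 (Y (X 2))]
  ring

lemma divergence_jacDer (b c : B₃(R)) : divergence (jacDer b c) = 0 := by
  simp only [divergence, jacDer_apply, jac, pderiv_X, Pi.single_apply, map_add, map_sub,
    Derivation.leibniz, smul_eq_mul]
  simp
  rw [pderiv_comm 1 0, pderiv_comm 2 0, pderiv_comm 2 1, pderiv_comm 1 0, pderiv_comm 2 0,
    pderiv_comm 2 1]
  ring

/-- The determinant of three derivations. -/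
noncomputable def detDer (Y Z W : Derivation R B₃(R) B₃(R)) : B₃(R) :=
  Y (X 0) * (Z (X 1) * W (X 2) - Z (X 2) * W (X 1)) +
  Y (X 1) * (Z (X 2) * W (X 0) - Z (X 0) * W (X 2)) +
  Y (X 2) * (Z (X 0) * W (X 1) - Z (X 1) * W (X 0))

lemma derivation_detDer (D Y Z W : Derivation R B₃(R) B₃(R)) :
    D (detDer Y Z W) = detDer ⁅D, Y⁆ Z W + detDer Y ⁅D, Z⁆ W + detDer Y Z ⁅D, W⁆ +
      divergence D * detDer Y Z W := by
  simp only [detDer, Derivation.commutator_apply, map_add, map_sub, Derivation.leibniz,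
    smul_eq_mul, divergence]
  rw [derivation_apply_eq Y (D (X 0)), derivation_apply_eq Y (D (X 1)),
    derivation_apply_eq Y (D (X 2)), derivation_apply_eq Z (D (X 0)),
    derivation_apply_eq Z (D (X 1)), derivation_apply_eq Z (D (X 2)),
    derivation_apply_eq W (D (X 0)), derivation_apply_eq W (D (X 1)),
    derivation_apply_eq W (D (X 2))]
  ring

/-- Cramer's rule. -/
lemma detDer_smul (Y Z W V : Derivation R B₃(R) B₃(R)) :
    detDer Y Z W • V = detDer V Z W • Y + detDer Y V W • Z + detDer Y Z V • W := by
  apply derivation_ext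
  intro i
  fin_cases i <;> simp [detDer] <;> ring

lemma detDer_mul_pderiv {Y Z W : Derivation R B₃(R) B₃(R)} {b : B₃(R)} (hY : Y b = 0) (hZ : Z b = 0)
    (hW : W b = 0) (i : Fin 3) : detDer Y Z W * pderiv i b = 0 := by
  have := congrArg (fun V : Derivation R B₃(R) B₃(R) => V b) (detDer_smul Y Z W (pderiv i))
  simpa [hY, hZ, hW] using this

/-- A derivation mapping generators into an ideal maps everything into it. -/
lemma derivation_mem_of_adjoin {A : Type*} [CommRing A] [Algebra R A] (Z : Derivation R A A)
    (I : Ideal A) (s : Set A) (hs : ∀ x ∈ s, Z x ∈ I) (x : A) (hx : x ∈ Algebra.adjoin R s) :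
    Z x ∈ I := by
  induction hx using Algebra.adjoin_induction with
  | mem x hx => exact hs x hx
  | algebraMap r => simp
  | add x y _ _ hx hy => rw [map_add]; exact I.add_mem hx hy
  | mul x y _ _ hx hy =>
    rw [Derivation.leibniz]
    exact I.add_mem (I.mul_mem_left _ hy) (I.mul_mem_left _ hx)

/-- The Euler derivation. -/
noncomputable def euler : Derivation R B₃(R) B₃(R) := mkDerivation R X

lemma euler_monomial (s : Fin 3 →₀ ℕ) (r : R) :
    euler (monomial s r) = ((s 0 + s 1 + s 2 : ℕ) : B₃(R)) * monomial s r := by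
  rw [derivation_apply_eq]
  simp only [euler, mkDerivation_X, X_mul_pderiv_monomial]
  simp only [nsmul_eq_mul, Nat.cast_add, add_mul]

lemma coeff_euler (s : Fin 3 →₀ ℕ) (b : B₃(R)) :
    coeff s (euler b) = ((s 0 + s 1 + s 2 : ℕ) : R) * coeff s b := by
  induction b using MvPolynomial.induction_on' with
  | monomial t r =>
    rw [euler_monomial, ← C_eq_coe_nat, coeff_C_mul, coeff_monomial]
    split_ifs with h
    · rw [h]
    · simp
  | add p q hp hq => rw [map_add, coeff_add, coeff_add, hp, hq, mul_add]

lemma euler_add_injective [IsDomain R] [CharZero R] (n : ℕ) (hn : n ≠ 0) (b : B₃(R))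
    (h : euler b + n * b = 0) : b = 0 := by
  ext s
  have := congrArg (coeff s) h
  rw [coeff_add, coeff_euler, ← C_eq_coe_nat, coeff_C_mul, ← add_mul, coeff_zero,
    ← Nat.cast_add] at this
  rw [coeff_zero]
  refine (mul_eq_zero.mp this).resolve_left ?_
  exact Nat.cast_ne_zero.mpr (by lia)

lemma divergence_euler : divergence (euler : Derivation R B₃(R) B₃(R)) = 3 := by
  simp [divergence, euler, pderiv_X]; norm_num

lemma eq_C_of_pderiv_eq_zero [IsDomain R] [CharZero R] {b : B₃(R)} (h : ∀ i, pderiv i b = 0) :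
    b = C (coeff 0 b) := by
  have h0 : euler b = 0 := by rw [derivation_apply_eq, h, h, h]; simp
  ext s
  rw [coeff_C]
  split_ifs with hs
  · rw [← hs]
  · have := congrArg (coeff s) h0
    rw [coeff_euler, coeff_zero] at this
    refine (mul_eq_zero.mp this).resolve_left ?_
    refine Nat.cast_ne_zero.mpr ?_
    intro h1
    apply hs
    ext i
    fin_cases i <;> simp <;> lia

/-- A locally nilpotent derivation of a polynomial ring is divergence free. -/
lemma divergence_eq_zero [IsDomain R] [CharZero R] {D : Derivation R B₃(R) B₃(R)}
    (hD : ∀ b, ∃ n : ℕ, D^[n] b = 0) : divergence D = 0 := by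
  classical
  set f : B₃(R) →+ B₃(R) := (D : B₃(R) →ₗ[R] B₃(R)).toAddMonoidHom + AddMonoidHom.mulLeft (divergence D)
    with hf
  have hfa : ∀ b, f b = D b + divergence D * b := fun b => rfl
  have hnil : ∃ N : ℕ, f^[N] 1 = 0 := by
    obtain ⟨i, hi⟩ := hD (X 0)
    obtain ⟨j, hj⟩ := hD (X 1)
    obtain ⟨k, hk⟩ := hD (X 2)
    refine ⟨i + j + k, ?_⟩
    rw [← jac_X]
    exact iterate_trilinear_eq_zero (D : B₃(R) →ₗ[R] B₃(R)).toAddMonoidHom f jac (by simp [jac])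
      (by simp [jac]) (by simp [jac]) (fun a b c => by rw [hfa]; exact derivation_jac D a b c)
      _ i j k _ _ _ le_rfl hi hj hk
  have h := Nat.find_spec hnil
  have hpos : Nat.find hnil ≠ 0 := by
    intro h0; rw [h0] at h; exact one_ne_zero h
  set n := Nat.find hnil - 1 with hn
  have hw : f^[n] 1 ≠ 0 := Nat.find_min hnil (by lia)
  rw [show Nat.find hnil = n + 1 by lia, Function.iterate_succ_apply', hfa] at h
  have h1 : D (f^[n] 1) = 0 :=
    Derivation.eq_zero_of_dvd_map hD ⟨-divergence D, by linear_combination h⟩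
  rw [h1, zero_add] at h
  exact (mul_eq_zero.mp h).resolve_right hw

end MvPolynomial

namespace IsSl2Action

section Domain

variable {k R B : Type*} [Field k] [CharZero k] [CommRing R] [CommRing B] [Algebra R B]
    [Algebra k R] [Algebra k B] [IsScalarTower k R B] {D U E : Derivation R B B}

omit [CharZero k] in
lemma aeval_e_apply {x t : B} (hx : E x = t * x) (ht : E t = 0) (χ : Polynomial k) :
    Polynomial.aeval (E.toLinearMap.restrictScalars k : Module.End k B) χ x =
      Polynomial.aeval t χ * x := by
  have hpow : ∀ n : ℕ, E^[n] x = t ^ n * x := by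
    intro n
    induction n with
    | zero => simp
    | succ n ih =>
      rw [Function.iterate_succ_apply', ih, Derivation.leibniz, Derivation.leibniz_pow, ht, hx]
      simp only [smul_eq_mul]
      ring
  induction χ using Polynomial.induction_on' with
  | add p q hp hq => rw [map_add, map_add, LinearMap.add_apply, hp, hq, add_mul]
  | monomial n a =>
    rw [Polynomial.aeval_monomial, Polynomial.aeval_monomial, Module.End.mul_apply,
      pow_restrictScalars_apply, hpow, Module.algebraMap_end_apply, Algebra.smul_def, mul_assoc]

lemma e_iterate_u_comm (h : IsSl2Action k D U E) (x : B) (n : ℕ) :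
    U^[n] (E x) = E (U^[n] x) + 2 * n * U^[n] x := by
  induction n with
  | zero => simp
  | succ n ih =>
    have h1 := U.leibniz (2 * n : B) (U^[n] x)
    have h2 : U (2 * n : B) = 0 := by
      have := U.map_natCast (2 * n)
      push_cast at this
      exact this
    rw [h2] at h1
    rw [Function.iterate_succ_apply', ih, map_add, h1, Function.iterate_succ_apply', h.eu]
    simp only [smul_eq_mul]
    push_cast
    ring

variable [IsDomain B]

/-- Prime factors of homogeneous elements of `ker D` are homogeneous elements of `ker D`. -/
lemma exists_weight_of_prime_dvd (h : IsSl2Action k D U E) {a p : B} {n : ℕ} (ha0 : a ≠ 0)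
    (ha : D a = 0) (hn : E a = n * a) (hp : Prime p) (hpa : p ∣ a)
    (hfin : FiniteMultiplicity p a) : D p = 0 ∧ ∃ t : ℕ, E p = t * p := by
  have hchar : CharZero B := charZero_of_injective_algebraMap (algebraMap k B).injective
  have hDp : D p = 0 := by
    obtain ⟨c, rfl⟩ := hpa
    exact Derivation.eq_zero_of_map_mul h.lnd_d ha0 ha
  refine ⟨hDp, ?_⟩
  have hdvd : p ∣ E p := by
    obtain ⟨q, hq, hpq⟩ := hfin.exists_eq_pow_mul_and_not_dvd
    obtain ⟨l, hl⟩ : ∃ l, multiplicity p a = l + 1 := by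
      refine Nat.exists_eq_succ_of_ne_zero ?_
      intro h0
      rw [h0, pow_zero, one_mul] at hq
      exact hpq (hq ▸ hpa)
    rw [hl] at hq
    rw [hq, Derivation.leibniz, Derivation.leibniz_pow] at hn
    simp only [smul_eq_mul, Nat.add_sub_cancel, nsmul_eq_mul] at hn
    have h1 : ((l + 1 : ℕ) : B) * (E p * q) = p * (n * q - E q) := by
      refine mul_left_cancel₀ (pow_ne_zero l hp.ne_zero) ?_
      linear_combination hn
    have h2 : E p * q = p * (algebraMap k B ((l + 1 : ℕ) : k)⁻¹ * (n * q - E q)) := by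
      have h3 : algebraMap k B ((l + 1 : ℕ) : k)⁻¹ * ((l + 1 : ℕ) : B) = 1 := by
        rw [← map_natCast (algebraMap k B), ← map_mul,
          inv_mul_cancel₀ (Nat.cast_ne_zero.mpr l.succ_ne_zero), map_one]
      linear_combination (algebraMap k B ((l + 1 : ℕ) : k)⁻¹) * h1 - E p * q * h3
    exact (hp.dvd_or_dvd ⟨_, h2⟩).resolve_right hpq
  obtain ⟨t, ht⟩ := hdvd
  by_cases ht0 : t = 0
  · exact ⟨0, by rw [ht, ht0]; simp⟩
  have hDt : D t = 0 := by
    refine Derivation.eq_zero_of_map_mul (b := p) h.lnd_d (mul_ne_zero ht0 hp.ne_zero) ?_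
    have := h.ed p
    rw [hDp, map_zero] at this
    rw [mul_comm, ← ht]
    linear_combination -this
  have hUt : U t = 0 := by
    obtain ⟨i, hi, hi'⟩ := Derivation.exists_last_iterate h.lnd_u hp.ne_zero
    obtain ⟨l, hl, hl'⟩ := Derivation.exists_last_iterate h.lnd_u ht0
    obtain ⟨-, c, hc, h2⟩ := U.iterate_mul_of_iterate_eq_zero _ i l p t rfl hi' hl'
    cases l with
    | zero => simpa using hl'
    | succ l =>
      exfalso
      rw [← ht, show i + (l + 1) = l + (i + 1) by lia, Function.iterate_add_apply,
        h.e_iterate_u_comm, hi', map_zero, mul_zero, add_zero, iterate_map_zero] at h2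
      exact mul_ne_zero (Nat.cast_ne_zero.mpr hc) (mul_ne_zero hi hl) h2.symm
  have hEt := h.e_eq_zero hDt hUt
  obtain ⟨s, hs⟩ := IsIntegrableSl2.exists_weights h p
  rw [aeval_e_apply (by rw [ht, mul_comm]) hEt] at hs
  have h0 := (mul_eq_zero.mp hs).resolve_right hp.ne_zero
  rw [map_multiset_prod, Multiset.prod_eq_zero_iff, Multiset.map_map, Multiset.mem_map] at h0
  obtain ⟨i, -, hi⟩ := h0
  have hti : t = (i : B) := by
    simp only [Function.comp, map_sub, Polynomial.aeval_X, Polynomial.aeval_C, map_intCast] at hi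
    exact sub_eq_zero.mp hi
  have hEp : E p = (i : B) * p := by rw [ht, hti, mul_comm]
  have hi0 : 0 ≤ i := by
    by_contra hneg
    exact hp.ne_zero (h.eq_zero_of_neg hDp hEp (not_le.mp hneg))
  obtain ⟨j, rfl⟩ := Int.eq_ofNat_of_zero_le hi0
  exact ⟨j, by simpa using hEp⟩

lemma map_unit (hD : ∀ b, ∃ n : ℕ, D^[n] b = 0) [CharZero B] {u : B} (hu : IsUnit u) :
    D u = 0 := by
  obtain ⟨v, hv⟩ := hu.exists_right_inv
  exact Derivation.eq_zero_of_map_mul (b := v) hD (by rw [hv]; exact one_ne_zero) (by rw [hv]; simp)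

lemma exists_weight_ne_zero (h : IsSl2Action k D U E) (hD : D ≠ 0) :
    ∃ (a : B) (n : ℕ), a ≠ 0 ∧ D a = 0 ∧ E a = n * a ∧ n ≠ 0 := by
  by_contra hcon
  push Not at hcon
  apply hD
  ext x
  refine h.string_induction (motive := fun x => D x = 0) ?_ ?_ x
  · intro c i a ha hc
    by_cases ha0 : a = 0
    · rw [ha0, iterate_map_zero, map_zero]
    · have hc0 := hcon a c ha0 ha hc
      have hua := h.u_eq_zero ha (by rw [hc, hc0]; simp)
      cases i with
      | zero => exact ha
      | succ i => rw [Function.iterate_succ_apply, hua, iterate_map_zero, map_zero]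
  · intro x y hx hy
    rw [map_add, hx, hy, add_zero]

variable [UniqueFactorizationMonoid B]

lemma exists_prime_weight (h : IsSl2Action k D U E) (hD : D ≠ 0) :
    ∃ (P : B) (m : ℕ), Prime P ∧ D P = 0 ∧ E P = m * P ∧ m ≠ 0 := by
  have hchar : CharZero B := charZero_of_injective_algebraMap (algebraMap k B).injective
  obtain ⟨a, n, ha0, ha, hn, hn0⟩ := h.exists_weight_ne_zero hD
  induction a using UniqueFactorizationMonoid.induction_on_prime with
  | h₁ => exact absurd rfl ha0
  | h₂ x hx =>
    rw [h.e_eq_zero (map_unit h.lnd_d hx) (map_unit h.lnd_u hx)] at hn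
    exact absurd hn.symm (mul_ne_zero (Nat.cast_ne_zero.mpr hn0) hx.ne_zero)
  | h₃ a p ha0' hp ih =>
    obtain ⟨hDp, t, ht⟩ := h.exists_weight_of_prime_dvd ha0 ha hn hp (dvd_mul_right _ _)
      (FiniteMultiplicity.of_prime_left hp ha0)
    by_cases ht0 : t = 0
    · refine ih ha0' ?_ ?_
      · rw [mul_comm] at ha ha0
        exact Derivation.eq_zero_of_map_mul h.lnd_d ha0 ha
      · rw [Derivation.leibniz, ht, ht0] at hn
        simp only [smul_eq_mul] at hn
        refine mul_left_cancel₀ hp.ne_zero ?_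
        linear_combination hn
    · exact ⟨p, t, hp, hDp, ht, ht0⟩

/-- If weight vectors in `ker D` satisfy the given proportionality, then `ker D` is generated by a
prime `P` of positive weight over the ring of invariants. -/
lemma exists_eq_mul_pow (h : IsSl2Action k D U E)
    (hprop : ∀ (p q : B) (m n : ℕ), D p = 0 → D q = 0 → E p = m * p → E q = n * q →
      m * p * U q = n * q * U p)
    {P : B} {m : ℕ} (hP : Prime P) (hDP : D P = 0) (hEP : E P = m * P) (hm : m ≠ 0) {a : B} (ha0 : a ≠ 0)
    (ha : D a = 0) {n : ℕ} (hn : E a = n * a) :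
    ∃ (s : B) (j : ℕ), D s = 0 ∧ U s = 0 ∧ a = s * P ^ j ∧ j * m = n := by
  have hchar : CharZero B := charZero_of_injective_algebraMap (algebraMap k B).injective
  have hcast : ∀ n : ℕ, n ≠ 0 → IsUnit (n : B) := fun n hn => by
    rw [← map_natCast (algebraMap k B)]
    exact (IsUnit.mk0 _ (Nat.cast_ne_zero.mpr hn)).map _
  have hPU : ¬ P ∣ U P := by
    intro hdvd
    have h1 := h.e_eq_zero hDP (Derivation.eq_zero_of_dvd_map h.lnd_u hdvd)
    rw [hEP] at h1
    exact mul_ne_zero (Nat.cast_ne_zero.mpr hm) hP.ne_zero h1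
  induction a using UniqueFactorizationMonoid.induction_on_prime generalizing n with
  | h₁ => exact absurd rfl ha0
  | h₂ x hx =>
    refine ⟨x, 0, map_unit h.lnd_d hx, map_unit h.lnd_u hx, by simp, ?_⟩
    rw [h.e_eq_zero (map_unit h.lnd_d hx) (map_unit h.lnd_u hx)] at hn
    have := (mul_eq_zero.mp hn.symm).resolve_right hx.ne_zero
    rw [Nat.cast_eq_zero] at this
    rw [this, zero_mul]
  | h₃ a p ha0' hp ih =>
    obtain ⟨hDp, t, ht⟩ := h.exists_weight_of_prime_dvd ha0 ha hn hp (dvd_mul_right _ _)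
      (FiniteMultiplicity.of_prime_left hp ha0)
    have hDa : D a = 0 := by
      rw [mul_comm] at ha ha0
      exact Derivation.eq_zero_of_map_mul h.lnd_d ha0 ha
    have hEa : E a = ((n - t : ℤ) : B) * a := by
      rw [Derivation.leibniz, ht] at hn
      simp only [smul_eq_mul] at hn
      refine mul_left_cancel₀ hp.ne_zero ?_
      push_cast
      linear_combination hn
    have hnt : 0 ≤ (n - t : ℤ) := by
      by_contra hneg
      exact ha0' (h.eq_zero_of_neg hDa hEa (not_le.mp hneg))
    obtain ⟨n', hn'⟩ := Int.eq_ofNat_of_zero_le hnt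
    rw [hn'] at hEa
    obtain ⟨s, j, hs, hs', rfl, hj⟩ := ih ha0' hDa (n := n') (by simpa using hEa)
    by_cases ht0 : t = 0
    · have hUp := h.u_eq_zero hDp (by rw [ht, ht0]; simp)
      exact ⟨p * s, j, by simp [hs, hDp], by simp [hs', hUp], by ring, by lia⟩
    · have hdvd : P ∣ p := by
        have h1 := hprop P p m t hDP hDp hEP ht
        have h2 : P ∣ t * p * U P := ⟨m * U p, by rw [← h1]; ring⟩
        rcases hP.dvd_or_dvd h2 with h3 | h3
        · rcases hP.dvd_or_dvd h3 with h4 | h4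
          · exact absurd (isUnit_of_dvd_unit h4 (hcast t ht0)) hP.not_isUnit
          · exact h4
        · exact absurd h3 hPU
      obtain ⟨u, hu⟩ := hP.associated_of_dvd hp hdvd
      have hu1 := map_unit h.lnd_d u.isUnit
      have hu2 := map_unit h.lnd_u u.isUnit
      have htm : t = m := by
        rw [← hu, Derivation.leibniz, h.e_eq_zero hu1 hu2, hEP] at ht
        simp only [smul_eq_mul, mul_zero, zero_add] at ht
        have h5 : ((t : B) - m) * (P * u) = 0 := by linear_combination -ht
        have h6 := (mul_eq_zero.mp h5).resolve_right (mul_ne_zero hP.ne_zero u.ne_zero)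
        exact_mod_cast sub_eq_zero.mp h6
      refine ⟨u * s, j + 1, by simp [hs, hu1], by simp [hs', hu2], by rw [← hu]; ring, ?_⟩
      rw [add_mul, hj]
      lia

/-- The basic structure of the algebra: `ker D` is generated by a prime `P` of weight `1` or `2`
over the ring of invariants. -/
lemma exists_generator (h : IsSl2Action k D U E) (hD : D ≠ 0)
    (hprop : ∀ (p q : B) (m n : ℕ), D p = 0 → D q = 0 → E p = m * p → E q = n * q →
      m * p * U q = n * q * U p) :
    ∃ (P : B) (m : ℕ), (m = 1 ∨ m = 2) ∧ Prime P ∧ D P = 0 ∧ E P = m * P ∧ ¬ P ∣ U P ∧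
      ∀ (a : B) (n : ℕ), a ≠ 0 → D a = 0 → E a = n * a →
        ∃ (s : B) (j : ℕ), D s = 0 ∧ U s = 0 ∧ a = s * P ^ j ∧ j * m = n := by
  have hchar : CharZero B := charZero_of_injective_algebraMap (algebraMap k B).injective
  have hcast : ∀ n : ℕ, n ≠ 0 → IsUnit (n : B) := fun n hn => by
    rw [← map_natCast (algebraMap k B)]
    exact (IsUnit.mk0 _ (Nat.cast_ne_zero.mpr hn)).map _
  obtain ⟨P, m, hP, hDP, hEP, hm⟩ := h.exists_prime_weight hD
  have hPU : ¬ P ∣ U P := by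
    intro hdvd
    have h1 := h.e_eq_zero hDP (Derivation.eq_zero_of_dvd_map h.lnd_u hdvd)
    rw [hEP] at h1
    exact mul_ne_zero (Nat.cast_ne_zero.mpr hm) hP.ne_zero h1
  have hfact := fun (a : B) (n : ℕ) (ha0 : a ≠ 0) (ha : D a = 0) (hn : E a = n * a) =>
    h.exists_eq_mul_pow hprop hP hDP hEP hm ha0 ha hn
  refine ⟨P, m, ?_, hP, hDP, hEP, hPU, hfact⟩
  by_contra hm12
  obtain ⟨l, rfl⟩ : ∃ l, m = l + 3 := ⟨m - 3, by lia⟩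
  have hDQ : D (U P) = (l + 3) * P := by rw [h.du, hDP, hEP]; push_cast; simp
  have hEQ : E (U P) = (l + 1) * U P := by
    rw [h.eu, hEP, Derivation.leibniz, Derivation.map_natCast]
    simp only [smul_eq_mul]
    push_cast
    ring
  have hnat : ∀ (X : Derivation R B B) (n : ℕ) (b : B), X (n * b) = n * X b := by
    intro X n b
    simp [Derivation.leibniz]
  have hDW : D (U (U P)) = (2 * l + 4) * U P := by
    have e : U ((l + 3) * P) = (l + 3) * U P := by exact_mod_cast hnat U (l + 3) P
    rw [h.du, hDQ, e, hEQ]; ring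
  have hEW : E (U (U P)) = (l - 1) * U (U P) := by
    have e : U ((l + 1) * U P) = (l + 1) * U (U P) := by exact_mod_cast hnat U (l + 1) (U P)
    rw [h.eu, hEQ, e]
    ring
  set H := (l + 3) * (P * U (U P)) - (l + 2) * (U P * U P) with hH
  have hmap : ∀ X : Derivation R B B, X H = (l + 3) * X (P * U (U P)) - (l + 2) * X (U P * U P) := by
    intro X
    have e1 : X ((l + 3) * (P * U (U P))) = (l + 3) * X (P * U (U P)) := by
      exact_mod_cast hnat X (l + 3) _
    have e2 : X ((l + 2) * (U P * U P)) = (l + 2) * X (U P * U P) := by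
      exact_mod_cast hnat X (l + 2) _
    rw [hH, map_sub, e1, e2]
  have hDH : D H = 0 := by
    rw [hmap, Derivation.leibniz, Derivation.leibniz, hDP, hDQ, hDW]
    simp only [smul_eq_mul]
    ring
  have hEH : E H = ((2 * l + 2 : ℕ) : B) * H := by
    rw [hmap, Derivation.leibniz, Derivation.leibniz, hEP, hEQ, hEW, hH]
    simp only [smul_eq_mul]
    push_cast
    ring
  have hPH : P ∣ H := by
    by_cases hH0 : H = 0
    · rw [hH0]; exact dvd_zero _
    · obtain ⟨s, j, -, -, hs, hj⟩ := hfact H _ hH0 hDH hEH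
      have hj0 : j ≠ 0 := by rintro rfl; lia
      rw [hs]
      exact Dvd.dvd.mul_left (dvd_pow_self P hj0) s
  have h1 : P ∣ ((l + 2 : ℕ) : B) * (U P * U P) := by
    have : ((l + 2 : ℕ) : B) * (U P * U P) = P * ((l + 3) * U (U P)) - H := by
      rw [hH]; push_cast; ring
    rw [this]
    exact dvd_sub (dvd_mul_right _ _) hPH
  rcases hP.dvd_or_dvd h1 with h2 | h2
  · exact hP.not_isUnit (isUnit_of_dvd_unit h2 (hcast _ (by lia)))
  · rcases hP.dvd_or_dvd h2 with h3 | h3 <;> exact hPU h3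

end Domain

end IsSl2Action

lemma Derivation.map_aeval' {R B : Type*} [CommRing R] [CommRing B] [Algebra R B]
    (Z : Derivation R B B) {T : Subalgebra R B} (hT : ∀ t ∈ T, Z t = 0) (a : B)
    (G : Polynomial T) : Z (Polynomial.aeval a G) = Polynomial.aeval a G.derivative * Z a := by
  induction G using Polynomial.induction_on' with
  | add p q hp hq => simp only [map_add, hp, hq, add_mul]
  | monomial n t =>
    rw [Polynomial.aeval_monomial, Polynomial.derivative_monomial, Polynomial.aeval_monomial,
      Derivation.leibniz, Derivation.leibniz_pow, map_mul]
    have h1 : Z (algebraMap T B t) = 0 := hT _ t.2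
    rw [h1]
    have h2 : algebraMap T B (n : T) = n := _root_.map_natCast _ n
    simp only [smul_eq_mul, nsmul_eq_mul, h2]
    ring

/-- An element moved by a derivation is transcendental over any ring of constants. -/
lemma Derivation.transcendental {R B : Type*} [CommRing R] [CommRing B] [IsDomain B] [CharZero B]
    [Algebra R B] (Z : Derivation R B B) {T : Subalgebra R B} (hT : ∀ t ∈ T, Z t = 0) {a : B}
    (ha : Z a ≠ 0) : Transcendental T a := by
  rw [transcendental_iff]
  intro G
  induction hn : G.natDegree using Nat.strong_induction_on generalizing G with
  | _ n ih =>
    intro hG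
    by_cases h0 : G.natDegree = 0
    · obtain ⟨c, rfl⟩ := Polynomial.natDegree_eq_zero.mp h0
      rw [Polynomial.aeval_C] at hG
      have : c = 0 := Subtype.ext hG
      rw [this, map_zero]
    · exfalso
      apply h0
      refine Polynomial.derivative_eq_zero.mp ?_
      refine ih _ (hn ▸ Polynomial.natDegree_derivative_lt h0) _ rfl ?_
      have := Z.map_aeval' hT a G
      rw [hG, map_zero] at this
      exact (mul_eq_zero.mp this.symm).resolve_right ha

namespace MvPolynomial

variable {R : Type*} [CommRing R]

lemma detDer_mul_jac (Y Z W : Derivation R B₃(R) B₃(R)) (a b c : B₃(R)) :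
    detDer Y Z W * jac a b c = Y a * (Z b * W c - Z c * W b) + Y b * (Z c * W a - Z a * W c) +
      Y c * (Z a * W b - Z b * W a) := by
  rw [derivation_apply_eq Y a, derivation_apply_eq Y b, derivation_apply_eq Y c,
    derivation_apply_eq Z a, derivation_apply_eq Z b, derivation_apply_eq Z c,
    derivation_apply_eq W a, derivation_apply_eq W b, derivation_apply_eq W c]
  simp only [detDer, jac]
  ring

/-- If all Jacobian determinants of generators lie in an ideal, the ideal is everything. -/
lemma one_mem_of_jac_mem {s : Set B₃(R)} (hs : Algebra.adjoin R s = ⊤) (I : Ideal B₃(R))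
    (h : ∀ a ∈ s, ∀ b ∈ s, ∀ c ∈ s, jac a b c ∈ I) : (1 : B₃(R)) ∈ I := by
  have hmem : ∀ x : B₃(R), x ∈ Algebra.adjoin R s := fun x => hs ▸ Algebra.mem_top
  have h1 : ∀ a, ∀ b ∈ s, ∀ c ∈ s, jac a b c ∈ I := by
    intro a b hb c hc
    rw [← jacDer_apply]
    refine derivation_mem_of_adjoin _ I s ?_ a (hmem a)
    intro x hx
    rw [jacDer_apply]
    exact h x hx b hb c hc
  have h2 : ∀ a b, ∀ c ∈ s, jac a b c ∈ I := by
    intro a b c hc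
    rw [jac_rotate, ← jacDer_apply]
    refine derivation_mem_of_adjoin _ I s ?_ b (hmem b)
    intro x hx
    rw [jacDer_apply, ← jac_rotate]
    exact h1 a x hx c hc
  have h3 : ∀ a b c, jac a b c ∈ I := by
    intro a b c
    rw [← jac_rotate, ← jacDer_apply]
    refine derivation_mem_of_adjoin _ I s ?_ c (hmem c)
    intro x hx
    rw [jacDer_apply, jac_rotate]
    exact h2 a b x hx
  rw [← jac_X]
  exact h3 _ _ _

lemma jac_mem_of_lt {ι : Type*} [LinearOrder ι] (g : ι → B₃(R)) (I : Ideal B₃(R))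
    (h : ∀ i j k, i < j → j < k → jac (g i) (g j) (g k) ∈ I) (i j k : ι) :
    jac (g i) (g j) (g k) ∈ I := by
  have hself : ∀ a b : B₃(R), jac a b b = 0 := fun a b => by simp only [jac]; ring
  have key : ∀ i j k, j < k → jac (g i) (g j) (g k) ∈ I := by
    intro i j k hjk
    rcases lt_trichotomy i j with h1 | rfl | h1
    · exact h i j k h1 hjk
    · rw [jac_rotate, jac_rotate, hself]; exact I.zero_mem
    · rcases lt_trichotomy i k with h2 | rfl | h2
      · rw [jac_rotate, jac_swap]
        exact I.neg_mem (h j i k h1 h2)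
      · rw [jac_rotate, hself]; exact I.zero_mem
      · rw [jac_rotate]; exact h j k i hjk h2
  rcases lt_trichotomy j k with h1 | rfl | h1
  · exact key i j k h1
  · rw [hself]; exact I.zero_mem
  · rw [jac_swap]; exact I.neg_mem (key i k j h1)

lemma one_mem_of_jac_mem_of_lt {ι : Type*} [LinearOrder ι] (g : ι → B₃(R))
    (hs : Algebra.adjoin R (Set.range g) = ⊤) (I : Ideal B₃(R))
    (h : ∀ i j k, i < j → j < k → jac (g i) (g j) (g k) ∈ I) : (1 : B₃(R)) ∈ I := by
  refine one_mem_of_jac_mem hs I ?_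
  rintro _ ⟨i, rfl⟩ _ ⟨j, rfl⟩ _ ⟨k, rfl⟩
  exact jac_mem_of_lt g I h i j k

end MvPolynomial

namespace IsSl2Action

variable {k R : Type*} [Field k] [CharZero k] [CommRing R] [Algebra k R]

variable {D U E : Derivation R B₃(R) B₃(R)}

section

omit [CharZero k]

lemma lie_d_u (h : IsSl2Action k D U E) : ⁅D, U⁆ = E := by
  refine Derivation.ext fun x => ?_
  rw [Derivation.commutator_apply, h.du]; ring

lemma lie_d_e (h : IsSl2Action k D U E) : ⁅D, E⁆ = (-2 : R) • D := by
  refine Derivation.ext fun x => ?_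
  rw [Derivation.commutator_apply, h.ed, Derivation.smul_apply, Algebra.smul_def, algebraMap_eq]
  simp [map_ofNat C 2]

lemma lie_u_e (h : IsSl2Action k D U E) : ⁅U, E⁆ = (2 : R) • U := by
  refine Derivation.ext fun x => ?_
  rw [Derivation.commutator_apply, h.eu, Derivation.smul_apply, Algebra.smul_def, algebraMap_eq]
  simp [map_ofNat C 2]

end

variable [IsDomain R] [CharZero R]

omit [CharZero k] in
lemma divergence_d (h : IsSl2Action k D U E) : divergence D = 0 := divergence_eq_zero h.lnd_d

omit [CharZero k] in
lemma divergence_u (h : IsSl2Action k D U E) : divergence U = 0 := divergence_eq_zero h.lnd_u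

omit [CharZero k] in
lemma divergence_e (h : IsSl2Action k D U E) : divergence E = 0 := by
  rw [← h.lie_d_u, divergence_lie, h.divergence_d, h.divergence_u]; simp

/-- The three derivations of an `sl₂`-action on affine three-space are dependent. -/
lemma detDer_eq_zero (h : IsSl2Action k D U E) : detDer D E U = 0 := by
  have hD : D (detDer D E U) = 0 := by
    rw [derivation_detDer, lie_self, h.lie_d_e, h.lie_d_u, h.divergence_d]
    simp only [detDer, Derivation.smul_apply, Algebra.smul_def, Derivation.zero_apply]
    ring
  have hU : U (detDer D E U) = 0 := by
    rw [derivation_detDer, lie_self, h.lie_u_e, ← lie_skew, h.lie_d_u, h.divergence_u]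
    simp only [detDer, Derivation.smul_apply, Algebra.smul_def, Derivation.zero_apply,
      Derivation.neg_apply]
    ring
  have hE := h.e_eq_zero hD hU
  by_cases hp : ∀ i, pderiv i (detDer D E U) = 0
  · have h1 := congrArg divergence (detDer_smul D E U euler)
    simp only [divergence_add, divergence_smul, h.divergence_d, h.divergence_u, h.divergence_e,
      divergence_euler] at h1
    have h2 : euler (detDer D E U) = 0 := by rw [derivation_apply_eq, hp, hp, hp]; simp
    set a := detDer euler E U
    set b := detDer D euler U
    set c := detDer D E euler
    have h3 : detDer D E U * 3 = D (a + U b) + U (c - D b) := by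
      rw [map_add, map_sub, h.du]
      linear_combination h1 - h2
    have h4 : ∀ X : Derivation R B₃(R) B₃(R), X (detDer D E U) = 0 → X (detDer D E U * 3) = 0 := by
      intro X hX
      have : X (3 : B₃(R)) = 0 := X.map_natCast 3
      rw [Derivation.leibniz, hX, this]; simp
    have h5 := h.eq_zero_of_mem_range (h4 D hD) (h4 U hU) h3
    simpa using h5
  · push Not at hp
    obtain ⟨i, hi⟩ := hp
    exact (mul_eq_zero.mp (detDer_mul_pderiv hD hE hU i)).resolve_right hi

lemma weight_mul_u (h : IsSl2Action k D U E) (hD : D ≠ 0) (p q : B₃(R)) (m n : ℕ) (hp : D p = 0)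
    (hq : D q = 0) (hm : E p = m * p) (hn : E q = n * q) : m * p * U q = n * q * U p := by
  obtain ⟨x, hx⟩ : ∃ x, D x ≠ 0 := by
    by_contra hcon
    push Not at hcon
    exact hD (Derivation.ext hcon)
  have := detDer_mul_jac D E U x p q
  rw [h.detDer_eq_zero, zero_mul, hp, hq, zero_mul, zero_mul, add_zero, add_zero] at this
  rw [← hm, ← hn]
  exact sub_eq_zero.mp ((mul_eq_zero.mp this.symm).resolve_left hx)

end IsSl2Action

/-- A nonzero polynomial relation on `a` with coefficients in a subalgebra can be chosen with
nonzero constant coefficient. -/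
lemma exists_dvd_of_isAlgebraic {R B : Type*} [CommRing R] [CommRing B] [IsDomain B]
    [Algebra R B] {T : Subalgebra R B} {a : B} (ha : a ≠ 0) (halg : IsAlgebraic T a) :
    ∃ c ∈ T, c ≠ 0 ∧ a ∣ c := by
  obtain ⟨G, hG0, hG⟩ := halg
  obtain ⟨G', hG', hdvd⟩ := Polynomial.exists_eq_pow_rootMultiplicity_mul_and_not_dvd G hG0 0
  rw [map_zero, sub_zero] at hG' hdvd
  rw [Polynomial.X_dvd_iff] at hdvd
  refine ⟨_, (G'.coeff 0).2, fun h => hdvd (Subtype.ext h), ?_⟩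
  rw [hG', map_mul, map_pow, Polynomial.aeval_X] at hG
  have h1 := (mul_eq_zero.mp hG).resolve_left (pow_ne_zero _ ha)
  have h2 := G'.divX_mul_X_add
  rw [← h2, map_add, map_mul, Polynomial.aeval_X, Polynomial.aeval_C] at h1
  refine ⟨-Polynomial.aeval a G'.divX, ?_⟩
  change algebraMap T B (G'.coeff 0) = _
  linear_combination h1

namespace IsSl2Action

variable {R : Type*} [CommRing R]

/-- The subalgebra of invariants. -/
def invariants (D U : Derivation R B₃(R) B₃(R)) : Subalgebra R B₃(R) where
  carrier := {s | D s = 0 ∧ U s = 0}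
  mul_mem' := by
    rintro a b ⟨h1, h2⟩ ⟨h3, h4⟩
    exact ⟨by simp [h1, h3], by simp [h2, h4]⟩
  add_mem' := by
    rintro a b ⟨h1, h2⟩ ⟨h3, h4⟩
    exact ⟨by simp [h1, h3], by simp [h2, h4]⟩
  algebraMap_mem' r := by simp

variable {D U : Derivation R B₃(R) B₃(R)}

/-- The kernel of a derivation as a subalgebra. -/
def constants (D : Derivation R B₃(R) B₃(R)) : Subalgebra R B₃(R) where
  carrier := {s | D s = 0}
  mul_mem' := by
    intro a b (h1 : D a = 0) (h3 : D b = 0)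
    simp [h1, h3]
  add_mem' := by
    intro a b (h1 : D a = 0) (h3 : D b = 0)
    simp [h1, h3]
  algebraMap_mem' r := by simp

variable [IsDomain R] [CharZero R]

lemma isAlgebraic_of_mem_invariants {P p q : B₃(R)}
    (hDP : D P = 0) (hUP : U P ≠ 0) (hDUP : D (U P) ≠ 0) (hp : p ∈ invariants D U)
    (hq : q ∈ invariants D U) (htq : Transcendental R q) :
    IsAlgebraic (Algebra.adjoin R {q}) p := by
  by_contra htp
  have h1 : AlgebraicIndependent R ![q] :=
    (algebraicIndependent_iff_transcendental).mpr htq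
  have h2 := (h1.option_iff_transcendental p).mpr (by
    have : Set.range ![q] = {q} := by simp
    rw [this]
    exact htp)
  have h3 := (h2.option_iff_transcendental P).mpr (by
    refine U.transcendental (fun t ht => ?_) hUP
    refine (Algebra.adjoin_le (S := invariants D U) ?_ ht).2
    rintro _ ⟨o, rfl⟩
    rcases o with _ | i
    · exact hp
    · fin_cases i; exact hq)
  have h4 := (h3.option_iff_transcendental (U P)).mpr (by
    refine D.transcendental (fun t ht => ?_) hDUP
    refine Algebra.adjoin_le (S := constants D) ?_ ht
    rintro _ ⟨o, rfl⟩
    rcases o with _ | _ | i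
    · exact hDP
    · exact hp.1
    · fin_cases i; exact hq.1)
  have h5 := h4.lift_cardinalMk_le_trdeg
  rw [MvPolynomial.trdeg_of_isDomain] at h5
  simp only [Cardinal.mk_fintype, Fintype.card_option, Fintype.card_fin,
    Cardinal.lift_natCast] at h5
  norm_cast at h5

/-- A prime invariant without constant term divides all invariants without constant term. -/
lemma dvd_of_constantCoeff_eq_zero {P p q : B₃(R)}
    (hDP : D P = 0) (hUP : U P ≠ 0) (hDUP : D (U P) ≠ 0) (hp : p ∈ invariants D U)
    (hq : q ∈ invariants D U) (hprime : Prime p) (hεp : constantCoeff p = 0)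
    (hεq : constantCoeff q = 0) : p ∣ q := by
  obtain ⟨F, hF0, hF⟩ : ∃ F : Polynomial R, F ≠ 0 ∧ p ∣ Polynomial.aeval q F := by
    by_cases htq : Transcendental R q
    · have halg := isAlgebraic_of_mem_invariants hDP hUP hDUP hp hq htq
      obtain ⟨c, hc, hc0, hpc⟩ := exists_dvd_of_isAlgebraic hprime.ne_zero halg
      rw [Algebra.adjoin_singleton_eq_range_aeval] at hc
      obtain ⟨F, rfl⟩ := hc
      exact ⟨F, by rintro rfl; simp at hc0, hpc⟩
    · rw [Transcendental, not_not] at htq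
      obtain ⟨F, hF0, hF⟩ := htq
      exact ⟨F, hF0, by rw [hF]; exact dvd_zero _⟩
  obtain ⟨G, hG, hdvd⟩ := Polynomial.exists_eq_pow_rootMultiplicity_mul_and_not_dvd F hF0 0
  rw [map_zero, sub_zero] at hG hdvd
  rw [Polynomial.X_dvd_iff] at hdvd
  rw [hG, map_mul, map_pow, Polynomial.aeval_X] at hF
  rcases hprime.dvd_or_dvd hF with h1 | h1
  · exact hprime.dvd_of_dvd_pow h1
  · exfalso
    obtain ⟨y, hy⟩ := h1
    have h2 := congrArg constantCoeff hy
    rw [map_mul, hεp, zero_mul, ← G.divX_mul_X_add, map_add, map_mul, Polynomial.aeval_X,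
      Polynomial.aeval_C, map_add, map_mul, hεq, mul_zero, zero_add, algebraMap_eq,
      constantCoeff_C] at h2
    exact hdvd h2

lemma exists_aeval_eq {P p : B₃(R)} (hD : ∀ b, ∃ n : ℕ, D^[n] b = 0) (hU : ∀ b, ∃ n : ℕ, U^[n] b = 0)
    (hDP : D P = 0) (hUP : U P ≠ 0) (hDUP : D (U P) ≠ 0) (hp : p ∈ invariants D U)
    (hprime : Prime p) (hεp : constantCoeff p = 0) (q : B₃(R))
    (hq : q ∈ invariants D U) : ∃ F : Polynomial R, q = Polynomial.aeval p F := by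
  induction hn : q.totalDegree using Nat.strong_induction_on generalizing q with
  | _ n ih =>
    have h1 : q - C (constantCoeff q) ∈ invariants D U :=
      sub_mem hq ((invariants D U).algebraMap_mem _)
    obtain ⟨y, hy⟩ := dvd_of_constantCoeff_eq_zero hDP hUP hDUP hp h1 hprime hεp (by simp)
    by_cases hy0 : y = 0
    · refine ⟨Polynomial.C (constantCoeff q), ?_⟩
      rw [hy0, mul_zero, sub_eq_zero] at hy
      rw [Polynomial.aeval_C]
      exact hy
    · have hne : y * p ≠ 0 := mul_ne_zero hy0 hprime.ne_zero
      have hy1 : y ∈ invariants D U := by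
        rw [hy, mul_comm] at h1
        exact ⟨Derivation.eq_zero_of_map_mul hD hne h1.1,
          Derivation.eq_zero_of_map_mul hU hne h1.2⟩
      have hdeg : y.totalDegree < n := by
        have h2 := totalDegree_mul_of_isDomain hprime.ne_zero hy0
        rw [← hy] at h2
        have h3 := totalDegree_sub_C_le q (constantCoeff q)
        have h4 : p.totalDegree ≠ 0 := by
          intro h0
          rw [totalDegree_eq_zero_iff_eq_C] at h0
          apply hprime.ne_zero
          rw [h0, ← constantCoeff_eq, hεp, map_zero]
        lia
      obtain ⟨F, hF⟩ := ih _ hdeg y hy1 rfl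
      refine ⟨Polynomial.X * F + Polynomial.C (constantCoeff q), ?_⟩
      rw [map_add, map_mul, Polynomial.aeval_X, Polynomial.aeval_C, ← hF, ← hy, algebraMap_eq]
      ring

end IsSl2Action

namespace IsSl2Action

variable {k R : Type*} [Field k] [CharZero k] [CommRing R] [Algebra k R]

variable {D U E : Derivation R B₃(R) B₃(R)}

section

omit [CharZero k]

lemma d_u_eq (h : IsSl2Action k D U E) {P : B₃(R)} {m : ℕ} (hD : D P = 0) (hE : E P = m * P) :
    D (U P) = m * P := by rw [h.du, hD, map_zero, zero_add, hE]

lemma e_u_eq (h : IsSl2Action k D U E) {P : B₃(R)} {m : ℕ} (hE : E P = m * P) :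
    E (U P) = (m - 2) * U P := by
  rw [h.eu, hE, Derivation.leibniz, Derivation.map_natCast, smul_eq_mul, smul_eq_mul]
  ring

lemma d_u_u_eq (h : IsSl2Action k D U E) {P : B₃(R)} {m : ℕ} (hD : D P = 0) (hE : E P = m * P) :
    D (U (U P)) = (2 * m - 2) * U P := by
  rw [h.du, h.d_u_eq hD hE, h.e_u_eq hE, Derivation.leibniz, Derivation.map_natCast,
    smul_eq_mul, smul_eq_mul]
  ring

end

lemma u_u_u_eq_zero (h : IsSl2Action k D U E) {P : B₃(R)} {m : ℕ} (hm : m = 1 ∨ m = 2)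
    (hD : D P = 0) (hE : E P = m * P) : U (U (U P)) = 0 := by
  have := h.iterate_u_eq_zero hD hE
  rcases hm with rfl | rfl
  · have h2 : U (U P) = 0 := this
    rw [h2, map_zero]
  · exact this

/-- The discriminant of the binary quadratic form with leading coefficient of weight two. -/
lemma discr_mem_invariants (h : IsSl2Action k D U E) {P : B₃(R)}
    (hD : D P = 0) (hE : E P = (2 : ℕ) * P) :
    2 * P * U (U P) - U P ^ 2 ∈ invariants D U := by
  have h0 := h.u_u_u_eq_zero (Or.inr rfl) hD hE
  have h1 := h.d_u_eq hD hE
  have h2 := h.d_u_u_eq hD hE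
  have hc : ∀ X : Derivation R B₃(R) B₃(R), X 2 = 0 := fun X => X.map_natCast 2
  constructor
  · simp only [map_sub, Derivation.leibniz, Derivation.leibniz_pow, smul_eq_mul, hD, h1, h2, hc]
    norm_num
    ring
  · simp only [map_sub, Derivation.leibniz, Derivation.leibniz_pow, smul_eq_mul, h0, hc]
    norm_num
    ring

variable [IsDomain R] [CharZero R]

lemma adjoin_eq_top (h : IsSl2Action k D U E) {P : B₃(R)} {m : ℕ} (hm : m = 1 ∨ m = 2)
    (hDP : D P = 0) (hEP : E P = m * P)
    (hfac : ∀ (a : B₃(R)) (n : ℕ), a ≠ 0 → D a = 0 → E a = n * a →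
      ∃ (s : B₃(R)) (j : ℕ), D s = 0 ∧ U s = 0 ∧ a = s * P ^ j ∧ j * m = n)
    {A : Subalgebra R B₃(R)} (hS : invariants D U ≤ A) (hP : P ∈ A) (hUP : U P ∈ A)
    (hUUP : U (U P) ∈ A) : A = ⊤ := by
  set A' := Algebra.adjoin R ((invariants D U : Set B₃(R)) ∪ {P, U P, U (U P)}) with hA'
  have hle : A' ≤ A := by
    rw [hA', Algebra.adjoin_le_iff]
    rintro x (hx | rfl | rfl | rfl)
    · exact hS hx
    all_goals assumption
  have hgen : ∀ x ∈ (invariants D U : Set B₃(R)) ∪ {P, U P, U (U P)}, x ∈ A' :=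
    fun x hx => Algebra.subset_adjoin hx
  have hUA : ∀ x ∈ A', U x ∈ A' := by
    intro x hx
    rw [hA'] at hx
    induction hx using Algebra.adjoin_induction with
    | mem x hx =>
      rcases hx with hx | rfl | rfl | rfl
      · rw [hx.2]; exact zero_mem _
      · exact hgen _ (by simp)
      · exact hgen _ (by simp)
      · rw [h.u_u_u_eq_zero hm hDP hEP]; exact zero_mem _
    | algebraMap r => rw [Derivation.map_algebraMap]; exact zero_mem _
    | add x y _ _ hx hy => rw [map_add]; exact add_mem hx hy
    | mul x y hx' hy' hx hy =>
      rw [Derivation.leibniz]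
      exact add_mem (mul_mem hx' hy) (mul_mem hy' hx)
  refine top_unique fun x _ => hle ?_
  refine h.string_induction (motive := (· ∈ A')) ?_ ?_ x
  · intro c i a hDa hEa
    have ha : a ∈ A' := by
      by_cases ha0 : a = 0
      · rw [ha0]; exact zero_mem _
      · obtain ⟨s, j, hs1, hs2, rfl, -⟩ := hfac a c ha0 hDa hEa
        exact mul_mem (hgen _ (Or.inl ⟨hs1, hs2⟩)) (pow_mem (hgen _ (by simp)) _)
    induction i with
    | zero => exact ha
    | succ i ih => rw [Function.iterate_succ_apply']; exact hUA _ ih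
  · intro a b ha hb
    exact add_mem ha hb

/-- Some invariant is nonconstant. -/
lemma exists_invariant_ne_C (h : IsSl2Action k D U E) {P : B₃(R)} {m : ℕ} (hm : m = 1 ∨ m = 2)
    (hDP : D P = 0) (hEP : E P = m * P) (hP0 : P ≠ 0)
    (hfac : ∀ (a : B₃(R)) (n : ℕ), a ≠ 0 → D a = 0 → E a = n * a →
      ∃ (s : B₃(R)) (j : ℕ), D s = 0 ∧ U s = 0 ∧ a = s * P ^ j ∧ j * m = n) :
    ∃ q ∈ invariants D U, ∀ r, q ≠ C r := by
  by_contra! hcon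
  have htop : Algebra.adjoin R (Set.range ![P, U P, U (U P)]) = ⊤ := by
    refine h.adjoin_eq_top hm hDP hEP hfac ?_ ?_ ?_ ?_
    · intro q hq
      obtain ⟨r, rfl⟩ := hcon q hq
      exact Subalgebra.algebraMap_mem _ r
    · exact Algebra.subset_adjoin ⟨0, rfl⟩
    · exact Algebra.subset_adjoin ⟨1, rfl⟩
    · exact Algebra.subset_adjoin ⟨2, rfl⟩
  have hjac : jac P (U P) (U (U P)) = 0 := by
    rcases hm with rfl | rfl
    · have h2 : U (U P) = 0 := h.iterate_u_eq_zero hDP hEP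
      rw [h2]
      simp [jac]
    · obtain ⟨r, hr⟩ := hcon _ (h.discr_mem_invariants hDP hEP)
      have h1 : jac P (U P) (2 * P * U (U P) - U P ^ 2) = 2 * P * jac P (U P) (U (U P)) := by
        have hc : ∀ i : Fin 3, pderiv i (2 : B₃(R)) = 0 := fun i => (pderiv i).map_natCast 2
        simp only [jac, map_sub, Derivation.leibniz, Derivation.leibniz_pow, hc, smul_eq_mul]
        norm_num
        ring
      rw [hr] at h1
      have h2 : jac P (U P) (C r) = 0 := by simp [jac]
      rw [h2] at h1
      refine (mul_eq_zero.mp h1.symm).resolve_left ?_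
      exact mul_ne_zero two_ne_zero hP0
  have := one_mem_of_jac_mem_of_lt ![P, U P, U (U P)] htop ⊥ (by
    intro i j k hij hjk
    have : i = 0 ∧ j = 1 ∧ k = 2 := by
      fin_cases i <;> fin_cases j <;> fin_cases k <;> simp_all
    obtain ⟨rfl, rfl, rfl⟩ := this
    simpa using hjac)
  simp at this

lemma exists_prime_invariant (hD : ∀ b, ∃ n : ℕ, D^[n] b = 0)
    (hU : ∀ b, ∃ n : ℕ, U^[n] b = 0) [UniqueFactorizationMonoid R] {q : B₃(R)}
    (hq : q ∈ invariants D U) (hqC : ∀ r, q ≠ C r) :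
    ∃ p ∈ invariants D U, Prime p ∧ constantCoeff p = 0 := by
  have key : ∀ a : B₃(R), a ≠ 0 → a ∈ invariants D U → constantCoeff a = 0 →
      ∃ p ∈ invariants D U, Prime p ∧ constantCoeff p = 0 := by
    intro a
    induction a using UniqueFactorizationMonoid.induction_on_prime with
    | h₁ => intro h; exact absurd rfl h
    | h₂ x hx =>
      intro _ _ h0
      have := hx.map (constantCoeff (R := R) (σ := Fin 3))
      rw [h0] at this
      exact absurd this not_isUnit_zero
    | h₃ a p ha hp ih =>
      intro h0 hmem hε
      have h1 : p ∈ invariants D U :=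
        ⟨Derivation.eq_zero_of_map_mul hD h0 hmem.1, Derivation.eq_zero_of_map_mul hU h0 hmem.2⟩
      rw [map_mul, mul_eq_zero] at hε
      rcases hε with hε | hε
      · exact ⟨p, h1, hp, hε⟩
      · rw [mul_comm] at h0 hmem
        exact ih ha ⟨Derivation.eq_zero_of_map_mul hD h0 hmem.1,
          Derivation.eq_zero_of_map_mul hU h0 hmem.2⟩ hε
  refine key (q - C (constantCoeff q)) (sub_ne_zero.mpr (hqC _)) ?_ (by simp)
  exact sub_mem hq ((invariants D U).algebraMap_mem _)

/-- The structure of the ring of invariants and of the whole ring. -/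
lemma exists_structure (h : IsSl2Action k D U E) (hD : D ≠ 0) [UniqueFactorizationMonoid R] :
    ∃ (P g : B₃(R)) (m : ℕ), (m = 1 ∨ m = 2) ∧ P ≠ 0 ∧ D P = 0 ∧ E P = m * P ∧ ¬ P ∣ U P ∧
      (∀ (a : B₃(R)) (n : ℕ), a ≠ 0 → D a = 0 → E a = n * a →
        ∃ (s : B₃(R)) (j : ℕ), D s = 0 ∧ U s = 0 ∧ a = s * P ^ j ∧ j * m = n) ∧
      D g = 0 ∧ U g = 0 ∧ Transcendental R g ∧
      (∀ q, D q = 0 → U q = 0 → ∃ F : Polynomial R, q = Polynomial.aeval g F) ∧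
      Algebra.adjoin R {P, U P, U (U P), g} = ⊤ := by
  obtain ⟨P, m, hm, hP, hDP, hEP, hndvd, hfac⟩ := h.exists_generator hD (h.weight_mul_u hD)
  obtain ⟨q, hq, hqC⟩ := h.exists_invariant_ne_C hm hDP hEP hP.ne_zero hfac
  obtain ⟨g, hg, hgp, hεg⟩ := exists_prime_invariant h.lnd_d h.lnd_u hq hqC
  have hm0 : m ≠ 0 := by rcases hm with rfl | rfl <;> norm_num
  have hUP : U P ≠ 0 := fun h0 => hndvd (h0 ▸ dvd_zero P)
  have hDUP : D (U P) ≠ 0 := by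
    rw [h.d_u_eq hDP hEP]
    exact mul_ne_zero (Nat.cast_ne_zero.mpr hm0) hP.ne_zero
  have hS : ∀ q, D q = 0 → U q = 0 → ∃ F : Polynomial R, q = Polynomial.aeval g F :=
    fun q h1 h2 => exists_aeval_eq h.lnd_d h.lnd_u hDP hUP hDUP hg hgp hεg q ⟨h1, h2⟩
  refine ⟨P, g, m, hm, hP.ne_zero, hDP, hEP, hndvd, hfac, hg.1, hg.2, ?_, hS, ?_⟩
  · obtain ⟨i, hi⟩ : ∃ i, pderiv i g ≠ 0 := by
      by_contra! hcon
      have h1 := eq_C_of_pderiv_eq_zero hcon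
      rw [h1, constantCoeff_C] at hεg
      rw [hεg, map_zero] at h1
      exact hgp.ne_zero h1
    have h1 := (pderiv i : Derivation R B₃(R) B₃(R)).transcendental (T := ⊥) (a := g) (by
      intro t ht
      obtain ⟨r, rfl⟩ := Algebra.mem_bot.mp ht
      exact Derivation.map_algebraMap _ _) hi
    refine fun h2 => h1 (h2.extendScalars ?_)
    refine Function.Injective.of_comp (f := algebraMap (⊥ : Subalgebra R B₃(R)) B₃(R)) ?_
    rw [← RingHom.coe_comp, ← IsScalarTower.algebraMap_eq, algebraMap_eq]
    exact C_injective _ _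
  · refine h.adjoin_eq_top hm hDP hEP hfac ?_ ?_ ?_ ?_
    · rintro q ⟨h1, h2⟩
      obtain ⟨F, rfl⟩ := hS q h1 h2
      exact Polynomial.aeval_mem_adjoin_singleton _ _ |> Algebra.adjoin_mono (by simp)
    all_goals exact Algebra.subset_adjoin (by simp)

end IsSl2Action

namespace IsSl2Action

section

variable {k R : Type*} [Field k] [CommRing R] [Algebra k R]

/-- The sum of the images of two derivations. -/
noncomputable def exacts (D U : Derivation R B₃(R) B₃(R)) : Submodule R B₃(R) :=
  LinearMap.range (D : B₃(R) →ₗ[R] B₃(R)) ⊔ LinearMap.range (U : B₃(R) →ₗ[R] B₃(R))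

variable {D U E : Derivation R B₃(R) B₃(R)}

lemma mem_exacts {x : B₃(R)} : x ∈ exacts D U ↔ ∃ a b, x = D a + U b := by
  rw [exacts, Submodule.mem_sup]
  constructor
  · rintro ⟨_, ⟨a, rfl⟩, _, ⟨b, rfl⟩, rfl⟩
    exact ⟨a, b, rfl⟩
  · rintro ⟨a, b, rfl⟩
    exact ⟨_, ⟨a, rfl⟩, _, ⟨b, rfl⟩, rfl⟩

lemma map_d_mem_exacts (a : B₃(R)) : D a ∈ exacts D U := mem_exacts.mpr ⟨a, 0, by simp⟩

lemma map_u_mem_exacts (a : B₃(R)) : U a ∈ exacts D U := mem_exacts.mpr ⟨0, a, by simp⟩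

lemma mul_mem_exacts {t x : B₃(R)} (hD : D t = 0) (hU : U t = 0) (hx : x ∈ exacts D U) :
    t * x ∈ exacts D U := by
  obtain ⟨a, b, rfl⟩ := mem_exacts.mp hx
  exact mem_exacts.mpr ⟨t * a, t * b, by simp [hD, hU, mul_add]⟩

lemma map_e_mem_exacts (h : IsSl2Action k D U E) (a : B₃(R)) : E a ∈ exacts D U :=
  mem_exacts.mpr ⟨U a, -D a, by rw [h.du, map_neg]; ring⟩

variable [CharZero k]

lemma mem_exacts_of_intCast_mul (k : Type*) [Field k] [CharZero k] [Algebra k R] {n : ℤ} (hn : n ≠ 0) {x : B₃(R)} (hx : n * x ∈ exacts D U) :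
    x ∈ exacts D U := by
  have : x = algebraMap k R (n : k)⁻¹ • ((n : B₃(R)) * x) := by
    rw [algebraMap_smul, ← intCast_smul (k := k), inv_smul_smul₀ (Int.cast_ne_zero.mpr hn)]
  rw [this]
  exact Submodule.smul_mem _ _ hx

lemma mem_exacts_of_weight (h : IsSl2Action k D U E) {n : ℤ} (hn : n ≠ 0) {x : B₃(R)}
    (hx : E x = n * x) : x ∈ exacts D U :=
  mem_exacts_of_intCast_mul k hn (hx ▸ h.map_e_mem_exacts x)

lemma eq_zero_of_mem_exacts (h : IsSl2Action k D U E) {x : B₃(R)} (hd : D x = 0) (hu : U x = 0)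
    (hx : x ∈ exacts D U) : x = 0 := by
  obtain ⟨a, b, hx⟩ := mem_exacts.mp hx
  exact h.eq_zero_of_mem_range hd hu hx

lemma exists_sub_mem_exacts_of_mul (h : IsSl2Action k D U E) {P : B₃(R)}
    (hDP : D P = 0) (hEP : E P = (2 : ℕ) * P)
    (hfac : ∀ (a : B₃(R)) (n : ℕ), a ≠ 0 → D a = 0 → E a = n * a →
      ∃ (s : B₃(R)) (j : ℕ), D s = 0 ∧ U s = 0 ∧ a = s * P ^ j ∧ j * 2 = n) (x : B₃(R)) :
    ∃ t, D t = 0 ∧ U t = 0 ∧ P * x - t * (2 * P * U (U P) - U P ^ 2) ∈ exacts D U := by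
  have hP1 : ∀ y, P * U y + U P * y ∈ exacts D U := fun y => by
    have := map_u_mem_exacts (D := D) (U := U) (P * y)
    rw [Derivation.leibniz, smul_eq_mul, smul_eq_mul] at this
    convert this using 1; ring
  have hP2 : ∀ y, U P * U y + U (U P) * y ∈ exacts D U := fun y => by
    have := map_u_mem_exacts (D := D) (U := U) (U P * y)
    rw [Derivation.leibniz, smul_eq_mul, smul_eq_mul] at this
    convert this using 1; ring
  have hP3 : ∀ y, U (U P) * U y ∈ exacts D U := fun y => by
    have := map_u_mem_exacts (D := D) (U := U) (U (U P) * y)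
    rw [Derivation.leibniz, smul_eq_mul, smul_eq_mul,
      h.u_u_u_eq_zero (Or.inr rfl) hDP hEP, mul_zero, add_zero] at this
    exact this
  have hzero : ∀ y, P * y ∈ exacts D U → ∃ t, D t = 0 ∧ U t = 0 ∧
      P * y - t * (2 * P * U (U P) - U P ^ 2) ∈ exacts D U :=
    fun y hy => ⟨0, map_zero _, map_zero _, by simpa using hy⟩
  refine h.string_induction (motive := fun x => ∃ t, D t = 0 ∧ U t = 0 ∧
    P * x - t * (2 * P * U (U P) - U P ^ 2) ∈ exacts D U) ?_ ?_ x
  · intro c i a hDa hEa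
    by_cases ha0 : a = 0
    · refine hzero _ ?_
      rw [ha0, iterate_map_zero, mul_zero]
      exact zero_mem _
    obtain ⟨s, j, hDs, hUs, ha, -⟩ := hfac a c ha0 hDa hEa
    have hEs := h.e_eq_zero hDs hUs
    have hEj : E (P ^ j) = (2 * j : ℤ) * P ^ j := by
      rw [Derivation.leibniz_pow, hEP]
      rcases j with _ | j
      · simp
      · simp only [Nat.add_sub_cancel, smul_eq_mul, nsmul_eq_mul]
        push_cast
        ring
    match i with
    | 0 =>
      refine hzero _ (h.mem_exacts_of_weight (n := 2 * j + 2) (by lia) ?_)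
      subst ha
      simp only [Function.iterate_zero, id_eq, Derivation.leibniz, hEP, hEj, hEs, smul_eq_mul]
      push_cast
      ring
    | 1 =>
      refine hzero _ ?_
      change P * U a ∈ _
      have h1 : U P * a ∈ exacts D U := by
        refine mem_exacts_of_intCast_mul k (n := j + 1) (by lia) ?_
        have := mul_mem_exacts hDs hUs (map_u_mem_exacts (D := D) (U := U) (P ^ (j + 1)))
        rw [Derivation.leibniz_pow, Nat.add_sub_cancel, smul_eq_mul, nsmul_eq_mul] at this
        convert this using 1
        rw [ha]
        push_cast
        ring
      have := sub_mem (hP1 a) h1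
      rwa [add_sub_cancel_right] at this
    | 2 =>
      change ∃ t, D t = 0 ∧ U t = 0 ∧ P * U (U a) - t * _ ∈ _
      have h1 := sub_mem (hP1 (U a)) (hP2 a)
      by_cases hj : j = 1
      · refine ⟨algebraMap k R (3 : k)⁻¹ • s, by simp [hDs], by simp [hUs], ?_⟩
        refine mem_exacts_of_intCast_mul k (n := 3) (by lia) ?_
        have h3 : (3 : ℤ) * (P * U (U a) - (algebraMap k R (3 : k)⁻¹ • s) *
            (2 * P * U (U P) - U P ^ 2)) = (3 : ℤ) * (P * U (U a)) - s *
            (2 * P * U (U P) - U P ^ 2) := by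
          have h4 : ((3 : ℤ) : B₃(R)) * algebraMap k R (3 : k)⁻¹ • s = s := by
            rw [algebraMap_smul, ← intCast_smul (k := k), Int.cast_ofNat,
              smul_inv_smul₀ (by norm_num)]
          linear_combination (-(2 * P * U (U P) - U P ^ 2)) * h4
        rw [h3]
        have h5 := mul_mem_exacts hDs hUs (hP1 (U P))
        have h6 := add_mem ((exacts D U).smul_mem (3 : R) h1) h5
        convert h6 using 1
        rw [ha, hj, smul_eq_C_mul, map_ofNat]
        push_cast
        ring
      · refine hzero _ ?_
        have h2 : U (U P) * a ∈ exacts D U := by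
          refine h.mem_exacts_of_weight (n := 2 * j - 2) (by lia) ?_
          have h3 : E (U P) = 0 := by rw [h.e_u_eq hEP]; norm_num
          rw [ha]
          simp only [Derivation.leibniz, hEj, hEs, smul_eq_mul, h.eu (U P), h3, map_zero]
          push_cast
          ring
        have := add_mem h1 h2
        convert this using 1
        ring
    | n + 3 =>
      refine hzero _ ?_
      rw [add_comm, Function.iterate_add_apply]
      change P * U (U (U (U^[n] a))) ∈ _
      have := add_mem (sub_mem (hP1 (U (U (U^[n] a)))) (hP2 (U (U^[n] a)))) (hP3 (U^[n] a))
      convert this using 1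
      ring
  · rintro a b ⟨t, h1, h2, h3⟩ ⟨t', h1', h2', h3'⟩
    refine ⟨t + t', by rw [map_add, h1, h1', add_zero], by rw [map_add, h2, h2', add_zero], ?_⟩
    convert add_mem h3 h3' using 1
    ring

/-- The ideal of a quadratic form meets the invariants in the multiples of its discriminant,
modulo the images of the derivations. -/
lemma exists_sub_mem_exacts (h : IsSl2Action k D U E) {P : B₃(R)}
    (hDP : D P = 0) (hEP : E P = (2 : ℕ) * P)
    (hfac : ∀ (a : B₃(R)) (n : ℕ), a ≠ 0 → D a = 0 → E a = n * a →
      ∃ (s : B₃(R)) (j : ℕ), D s = 0 ∧ U s = 0 ∧ a = s * P ^ j ∧ j * 2 = n) (x y z : B₃(R)) :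
    ∃ t, D t = 0 ∧ U t = 0 ∧
      P * x + U P * y + U (U P) * z - t * (2 * P * U (U P) - U P ^ 2) ∈ exacts D U := by
  obtain ⟨t, h1, h2, h3⟩ := h.exists_sub_mem_exacts_of_mul hDP hEP hfac (x - U y + U (U z))
  refine ⟨t, h1, h2, ?_⟩
  have h4 := map_u_mem_exacts (D := D) (U := U) (P * y + U P * z - P * U z)
  convert add_mem h3 h4 using 1
  simp only [map_add, map_sub, Derivation.leibniz, smul_eq_mul]
  ring

end

end IsSl2Action

namespace IsSl2Action

variable {k R : Type*} [Field k] [CharZero k] [CommRing R] [Algebra k R]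
  [IsDomain R] [CharZero R]

variable {D U E : Derivation R B₃(R) B₃(R)}

lemma exists_jac_eq (h : IsSl2Action k D U E) {P g : B₃(R)}
    (hDP : D P = 0) (hEP : E P = (2 : ℕ) * P) (hP0 : P ≠ 0)
    (hfac : ∀ (a : B₃(R)) (n : ℕ), a ≠ 0 → D a = 0 → E a = n * a →
      ∃ (s : B₃(R)) (j : ℕ), D s = 0 ∧ U s = 0 ∧ a = s * P ^ j ∧ j * 2 = n)
    (hDg : D g = 0) (hUg : U g = 0) (htop : Algebra.adjoin R {P, U P, U (U P), g} = ⊤)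
    {F : Polynomial R} (hF : 2 * P * U (U P) - U P ^ 2 = Polynomial.aeval g F) :
    ∃ σ : R, IsUnit σ ∧ jac P (U P) g = C σ * P ∧ jac P (U (U P)) g = C σ * U P ∧
      jac (U P) (U (U P)) g = C σ * U (U P) ∧
      2 * jac P (U P) (U (U P)) = C σ * Polynomial.aeval g F.derivative := by
  have hjacc : ∀ a b : B₃(R), jac a a b = 0 := fun a b => by simp only [jac]; ring
  have hjacl : ∀ a b c r : B₃(R), (∀ i, pderiv i r = 0) → jac a (r * b) c = r * jac a b c := by
    intro a b c r hr
    simp only [jac, Derivation.leibniz, hr, smul_eq_mul]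
    ring
  have hjacl' : ∀ a b c r : B₃(R), (∀ i, pderiv i r = 0) → jac (r * a) b c = r * jac a b c := by
    intro a b c r hr
    simp only [jac, Derivation.leibniz, hr, smul_eq_mul]
    ring
  have hcast : ∀ (n : ℕ) (i : Fin 3), pderiv i (n : B₃(R)) = 0 :=
    fun n i => (pderiv i).map_natCast n
  have hjac0 : ∀ a b : B₃(R), jac a b 0 = 0 := by intro a b; simp [jac]
  have hjac0' : ∀ a b : B₃(R), jac a 0 b = 0 := by intro a b; simp [jac]
  have hjac0'' : ∀ a b : B₃(R), jac 0 a b = 0 := by intro a b; simp [jac]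
  have hEg := h.e_eq_zero hDg hUg
  have hEU : E (U P) = 0 := by rw [h.e_u_eq hEP]; norm_num
  have hDj : D (jac P (U P) g) = 0 := by
    have := derivation_jac D P (U P) g
    rw [h.divergence_d, hDP, hDg, h.d_u_eq hDP hEP, hjac0, hjac0'', hjacl _ _ _ _ (hcast 2),
      hjacc] at this
    simpa using this
  have hEj : E (jac P (U P) g) = (2 : ℕ) * jac P (U P) g := by
    have := derivation_jac E P (U P) g
    rw [h.divergence_e, hEP, hEg, hEU, hjac0, hjac0', hjacl' _ _ _ _ (hcast 2)] at this
    simpa using this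
  obtain ⟨σ, hDσ, hUσ, hσ⟩ : ∃ σ, D σ = 0 ∧ U σ = 0 ∧ jac P (U P) g = σ * P := by
    by_cases h0 : jac P (U P) g = 0
    · exact ⟨0, map_zero _, map_zero _, by rw [h0, zero_mul]⟩
    · obtain ⟨s, j, h1, h2, h3, h4⟩ := hfac _ 2 h0 hDj hEj
      have : j = 1 := by lia
      subst this
      exact ⟨s, h1, h2, by rw [h3, pow_one]⟩
  have h2 : jac P (U (U P)) g = σ * U P := by
    have := derivation_jac U P (U P) g
    rw [h.divergence_u, hUg, hjac0, hjacc, hσ, Derivation.leibniz, hUσ] at this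
    simpa using this.symm
  have h3 : jac (U P) (U (U P)) g = σ * U (U P) := by
    have := derivation_jac U P (U (U P)) g
    rw [h.divergence_u, hUg, hjac0, h.u_u_u_eq_zero (Or.inr rfl) hDP hEP, hjac0', h2,
      Derivation.leibniz, hUσ] at this
    simpa using this.symm
  have h4 : 2 * jac P (U P) (U (U P)) = σ * Polynomial.aeval g F.derivative := by
    have e1 : ∀ i, pderiv i (Polynomial.aeval g F) =
        Polynomial.aeval g F.derivative * pderiv i g := fun i => by
      rw [(pderiv i).map_aeval, smul_eq_mul]
    have e2 : jac P (U P) (Polynomial.aeval g F) =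
        Polynomial.aeval g F.derivative * jac P (U P) g := by
      simp only [jac, e1]; ring
    rw [← hF] at e2
    have e3 : jac P (U P) (2 * P * U (U P) - U P ^ 2) = 2 * P * jac P (U P) (U (U P)) := by
      have hc : ∀ i : Fin 3, pderiv i (2 : B₃(R)) = 0 := fun i => (pderiv i).map_natCast 2
      simp only [jac, map_sub, Derivation.leibniz, Derivation.leibniz_pow, hc, smul_eq_mul]
      norm_num
      ring
    rw [e3, hσ] at e2
    refine mul_left_cancel₀ hP0 ?_
    linear_combination e2
  have hunit : IsUnit σ := by
    have hr : Set.range ![P, U P, U (U P), g] = {P, U P, U (U P), g} := by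
      simp only [Matrix.range_cons, Matrix.range_empty, Set.union_empty, Set.singleton_union]
    have := one_mem_of_jac_mem_of_lt ![P, U P, U (U P), g] (hr ▸ htop) (Ideal.span {σ}) (by
      intro i j l hij hjl
      have : (i = 0 ∧ j = 1 ∧ l = 2) ∨ (i = 0 ∧ j = 1 ∧ l = 3) ∨ (i = 0 ∧ j = 2 ∧ l = 3) ∨
          (i = 1 ∧ j = 2 ∧ l = 3) := by lia
      rcases this with ⟨rfl, rfl, rfl⟩ | ⟨rfl, rfl, rfl⟩ | ⟨rfl, rfl, rfl⟩ | ⟨rfl, rfl, rfl⟩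
      · change jac P (U P) (U (U P)) ∈ _
        have : jac P (U P) (U (U P)) = algebraMap k R (2 : k)⁻¹ •
            (2 * jac P (U P) (U (U P))) := by
          rw [algebraMap_smul, two_mul, ← two_smul k, inv_smul_smul₀ two_ne_zero]
        rw [this, h4, smul_eq_C_mul]
        exact Ideal.mul_mem_left _ _ (Ideal.mul_mem_right _ _ (Ideal.mem_span_singleton_self σ))
      · change jac P (U P) g ∈ _
        rw [hσ]
        exact Ideal.mul_mem_right _ _ (Ideal.mem_span_singleton_self σ)
      · change jac P (U (U P)) g ∈ _
        rw [h2]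
        exact Ideal.mul_mem_right _ _ (Ideal.mem_span_singleton_self σ)
      · change jac (U P) (U (U P)) g ∈ _
        rw [h3]
        exact Ideal.mul_mem_right _ _ (Ideal.mem_span_singleton_self σ))
    exact isUnit_iff_dvd_one.mpr (Ideal.mem_span_singleton.mp this)
  obtain ⟨r, hr, rfl⟩ := MvPolynomial.isUnit_iff_eq_C_of_isReduced.mp hunit
  exact ⟨r, hr, hσ, h2, h3, h4⟩

lemma exists_bezout (h : IsSl2Action k D U E) {P g : B₃(R)}
    (hDP : D P = 0) (hEP : E P = (2 : ℕ) * P) (hP0 : P ≠ 0)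
    (hfac : ∀ (a : B₃(R)) (n : ℕ), a ≠ 0 → D a = 0 → E a = n * a →
      ∃ (s : B₃(R)) (j : ℕ), D s = 0 ∧ U s = 0 ∧ a = s * P ^ j ∧ j * 2 = n)
    (hDg : D g = 0) (hUg : U g = 0) (hg : Transcendental R g)
    (hS : ∀ q, D q = 0 → U q = 0 → ∃ F : Polynomial R, q = Polynomial.aeval g F)
    (htop : Algebra.adjoin R {P, U P, U (U P), g} = ⊤)
    {F : Polynomial R} (hF : 2 * P * U (U P) - U P ^ 2 = Polynomial.aeval g F) :
    ∃ S T : Polynomial R, F.derivative * S + F * T = 1 := by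
  obtain ⟨σ, -, h1, h2, h3, h4⟩ := h.exists_jac_eq hDP hEP hP0 hfac hDg hUg htop hF
  have hr : Set.range ![P, U P, U (U P), g] = {P, U P, U (U P), g} := by
    simp only [Matrix.range_cons, Matrix.range_empty, Set.union_empty, Set.singleton_union]
  have := one_mem_of_jac_mem_of_lt ![P, U P, U (U P), g] (hr ▸ htop)
    (Ideal.span {P, U P, U (U P), Polynomial.aeval g F.derivative}) (by
      intro i j l hij hjl
      have : (i = 0 ∧ j = 1 ∧ l = 2) ∨ (i = 0 ∧ j = 1 ∧ l = 3) ∨ (i = 0 ∧ j = 2 ∧ l = 3) ∨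
          (i = 1 ∧ j = 2 ∧ l = 3) := by lia
      rcases this with ⟨rfl, rfl, rfl⟩ | ⟨rfl, rfl, rfl⟩ | ⟨rfl, rfl, rfl⟩ | ⟨rfl, rfl, rfl⟩
      · change jac P (U P) (U (U P)) ∈ _
        have : jac P (U P) (U (U P)) = algebraMap k R (2 : k)⁻¹ •
            (2 * jac P (U P) (U (U P))) := by
          rw [algebraMap_smul, two_mul, ← two_smul k, inv_smul_smul₀ two_ne_zero]
        rw [this, h4, smul_eq_C_mul]
        exact Ideal.mul_mem_left _ _ (Ideal.mul_mem_left _ _ (Ideal.subset_span (by simp)))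
      · change jac P (U P) g ∈ _
        rw [h1]
        exact Ideal.mul_mem_left _ _ (Ideal.subset_span (by simp))
      · change jac P (U (U P)) g ∈ _
        rw [h2]
        exact Ideal.mul_mem_left _ _ (Ideal.subset_span (by simp))
      · change jac (U P) (U (U P)) g ∈ _
        rw [h3]
        exact Ideal.mul_mem_left _ _ (Ideal.subset_span (by simp)))
  obtain ⟨x, y', hy', hx⟩ := Ideal.mem_span_insert.mp this
  obtain ⟨y, z', hz', rfl⟩ := Ideal.mem_span_insert.mp hy'
  obtain ⟨z, w', hw', rfl⟩ := Ideal.mem_span_insert.mp hz'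
  obtain ⟨w, rfl⟩ := Ideal.mem_span_singleton'.mp hw'
  obtain ⟨t, hDt, hUt, ht⟩ := h.exists_sub_mem_exacts hDP hEP hfac x y z
  obtain ⟨s, a, b, hDs, hUs, rfl⟩ := h.exists_invariant w
  obtain ⟨T, rfl⟩ := hS t hDt hUt
  obtain ⟨S, rfl⟩ := hS s hDs hUs
  have hinv : ∀ G : Polynomial R, D (Polynomial.aeval g G) = 0 ∧ U (Polynomial.aeval g G) = 0 :=
    fun G => ⟨by rw [D.map_aeval, hDg, smul_zero], by rw [U.map_aeval, hUg, smul_zero]⟩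
  have h5 : Polynomial.aeval g F.derivative * (D a + U b) ∈ exacts D U :=
    mul_mem_exacts (hinv _).1 (hinv _).2 (mem_exacts.mpr ⟨a, b, rfl⟩)
  have h6 := add_mem ht h5
  have h7 := h.eq_zero_of_mem_exacts
    (hinv (1 - (F.derivative * S + F * T))).1 (hinv _).2 (by
      convert h6 using 1
      rw [hF]
      simp only [map_sub, map_add, map_mul, map_one]
      linear_combination hx)
  refine ⟨S, T, ?_⟩
  have h8 := (transcendental_iff.mp hg) _ h7
  exact (sub_eq_zero.mp h8).symm

end IsSl2Action

namespace MvPolynomial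

variable {R : Type*} [CommRing R]

lemma exists_euler_add_eq (k : Type*) [Field k] [CharZero k] [Algebra k R] {n : ℕ} (hn : n ≠ 0)
    (b : B₃(R)) : ∃ y : B₃(R), euler y + (n : B₃(R)) * y = b := by
  induction b using MvPolynomial.induction_on' with
  | monomial s r =>
    have hk : ((s 0 + s 1 + s 2 + n : ℕ) : k) ≠ 0 := Nat.cast_ne_zero.mpr (by lia)
    refine ⟨monomial s (algebraMap k R ((s 0 + s 1 + s 2 + n : ℕ) : k)⁻¹ * r), ?_⟩
    rw [euler_monomial, ← add_mul, ← Nat.cast_add, ← C_eq_coe_nat, C_mul_monomial, ← mul_assoc,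
      ← map_natCast (algebraMap k R), ← map_mul, mul_inv_cancel₀ hk, map_one, one_mul]
  | add p q hp hq =>
    obtain ⟨y, rfl⟩ := hp
    obtain ⟨z, rfl⟩ := hq
    exact ⟨y + z, by rw [map_add]; ring⟩

lemma pderiv_euler (i : Fin 3) (b : B₃(R)) :
    pderiv i (euler b) = euler (pderiv i b) + pderiv i b := by
  rw [pderiv_derivation]
  fin_cases i <;> simp [euler, pderiv_X]

/-- The Poincaré lemma for divergence-free derivations. -/
lemma exists_curl_eq (k : Type*) [Field k] [CharZero k] [Algebra k R] [IsDomain R] [CharZero R]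
    {Z : Derivation R B₃(R) B₃(R)} (hZ : divergence Z = 0) :
    ∃ a b c : B₃(R), pderiv 1 c - pderiv 2 b = Z (X 0) ∧ pderiv 2 a - pderiv 0 c = Z (X 1) ∧
      pderiv 0 b - pderiv 1 a = Z (X 2) := by
  obtain ⟨u, hu⟩ := exists_euler_add_eq k two_ne_zero (Z (X 0))
  obtain ⟨v, hv⟩ := exists_euler_add_eq k two_ne_zero (Z (X 1))
  obtain ⟨w, hw⟩ := exists_euler_add_eq k two_ne_zero (Z (X 2))
  have hc : ∀ (i : Fin 3), pderiv i ((2 : ℕ) : B₃(R)) = 0 :=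
    fun i => (pderiv i).map_natCast 2
  have hdiv : pderiv 0 u + pderiv 1 v + pderiv 2 w = 0 := by
    refine euler_add_injective 3 (by norm_num) _ ?_
    rw [divergence, ← hu, ← hv, ← hw] at hZ
    simp only [map_add, pderiv_euler, Derivation.leibniz, hc, smul_eq_mul] at hZ
    simp only [map_add]
    push_cast at hZ ⊢
    linear_combination hZ
  have he : ∀ y : B₃(R), euler y = X 0 * pderiv 0 y + X 1 * pderiv 1 y + X 2 * pderiv 2 y := by
    intro y
    rw [derivation_apply_eq]
    simp [euler]
  rw [he] at hu hv hw
  push_cast at hu hv hw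
  have hX : ∀ i j : Fin 3, pderiv i (X j : B₃(R)) = if i = j then 1 else 0 := by
    intro i j
    rw [pderiv_X, Pi.single_apply]
    simp [eq_comm]
  refine ⟨v * X 2 - w * X 1, w * X 0 - u * X 2, u * X 1 - v * X 0, ?_, ?_, ?_⟩
  · rw [← hu]
    simp only [map_sub, Derivation.leibniz, smul_eq_mul, hX]
    simp
    linear_combination (-X 0) * hdiv
  · rw [← hv]
    simp only [map_sub, Derivation.leibniz, smul_eq_mul, hX]
    simp
    linear_combination (-X 1) * hdiv
  · rw [← hw]
    simp only [map_sub, Derivation.leibniz, smul_eq_mul, hX]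
    simp
    linear_combination (-X 2) * hdiv

/-- The value of a one-form on a derivation. -/
noncomputable def oneForm (a b c : B₃(R)) (Z : Derivation R B₃(R) B₃(R)) : B₃(R) :=
  a * Z (X 0) + b * Z (X 1) + c * Z (X 2)

lemma oneForm_lie {V : Derivation R B₃(R) B₃(R)} {a b c : B₃(R)}
    (h0 : pderiv 1 c - pderiv 2 b = V (X 0)) (h1 : pderiv 2 a - pderiv 0 c = V (X 1))
    (h2 : pderiv 0 b - pderiv 1 a = V (X 2)) (Y Z : Derivation R B₃(R) B₃(R)) :
    Y (oneForm a b c Z) - Z (oneForm a b c Y) - oneForm a b c ⁅Y, Z⁆ = detDer V Y Z := by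
  simp only [oneForm, detDer, map_add, Derivation.leibniz, Derivation.commutator_apply,
    smul_eq_mul, ← h0, ← h1, ← h2]
  rw [derivation_apply_eq Y a, derivation_apply_eq Y b, derivation_apply_eq Y c,
    derivation_apply_eq Z a, derivation_apply_eq Z b, derivation_apply_eq Z c]
  ring

end MvPolynomial

namespace IsSl2Action

variable {k R : Type*} [Field k] [CharZero k] [CommRing R] [Algebra k R]
  [IsDomain R] [CharZero R]

variable {D U E : Derivation R B₃(R) B₃(R)}

/-- The action is determined by its quadratic invariant-covariant relation. -/
lemma two_mul_smul_u (h : IsSl2Action k D U E) {P g : B₃(R)}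
    (hDP : D P = 0) (hEP : E P = (2 : ℕ) * P) (hDg : D g = 0) (hUg : U g = 0)
    (htop : Algebra.adjoin R {P, U P, U (U P), g} = ⊤) :
    (2 * P) • U = U P • E + U (U P) • D := by
  have hEU : E (U P) = 0 := by rw [h.e_u_eq hEP]; norm_num
  refine Derivation.ext_of_adjoin_eq_top _ htop ?_
  rintro x (rfl | rfl | rfl | rfl)
  · simp [hDP, hEP]; ring
  · simp [hEU, h.d_u_eq hDP hEP]; ring
  · simp [h.d_u_u_eq hDP hEP, h.u_u_u_eq_zero (Or.inr rfl) hDP hEP, h.eu (U P), hEU]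
    ring
  · simp [hDg, hUg, h.e_eq_zero hDg hUg]

/-- The discriminant is not constant. -/
lemma derivative_ne_zero (h : IsSl2Action k D U E) {P g : B₃(R)}
    (hDP : D P = 0) (hEP : E P = (2 : ℕ) * P) (hP0 : P ≠ 0)
    (hfac : ∀ (a : B₃(R)) (n : ℕ), a ≠ 0 → D a = 0 → E a = n * a →
      ∃ (s : B₃(R)) (j : ℕ), D s = 0 ∧ U s = 0 ∧ a = s * P ^ j ∧ j * 2 = n)
    (hDg : D g = 0) (hUg : U g = 0) (hg : Transcendental R g)
    (hS : ∀ q, D q = 0 → U q = 0 → ∃ F : Polynomial R, q = Polynomial.aeval g F)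
    (htop : Algebra.adjoin R {P, U P, U (U P), g} = ⊤)
    {F : Polynomial R} (hF : 2 * P * U (U P) - U P ^ 2 = Polynomial.aeval g F) :
    F.derivative ≠ 0 := by
  intro hF'
  suffices h0 : 2 * P * U (U P) - U P ^ 2 = 0 by
    obtain ⟨S, T, hST⟩ := h.exists_bezout hDP hEP hP0 hfac hDg hUg hg hS htop hF
    rw [hF] at h0
    rw [(transcendental_iff.mp hg) _ h0] at hST
    simp at hST
  obtain ⟨σ, hσ, h1, -, -, h4⟩ := h.exists_jac_eq hDP hEP hP0 hfac hDg hUg htop hF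
  have hjac : jac P (U P) (U (U P)) = 0 := by
    rw [hF', map_zero, mul_zero] at h4
    exact (mul_eq_zero.mp h4).resolve_left two_ne_zero
  have hself : ∀ a b : B₃(R), jac a a b = 0 := fun a b => by simp only [jac]; ring
  have hself' : ∀ a b : B₃(R), jac a b a = 0 := fun a b => by simp only [jac]; ring
  have hdvd : ∀ x, P ∣ jacDer P (U P) x := by
    intro x
    rw [← Ideal.mem_span_singleton]
    refine derivation_mem_of_adjoin _ _ {P, U P, U (U P), g} ?_ x (htop ▸ Algebra.mem_top)
    rintro x (rfl | rfl | rfl | rfl) <;> rw [jacDer_apply]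
    · rw [hself]; exact zero_mem _
    · rw [hself']; exact zero_mem _
    · rw [jac_rotate, hjac]; exact zero_mem _
    · rw [jac_rotate, h1]; exact Ideal.mul_mem_left _ _ (Ideal.mem_span_singleton_self _)
  choose z hz using fun i => hdvd (X i)
  set V : Derivation R B₃(R) B₃(R) := mkDerivation R z with hV
  have hPV : P • V = jacDer P (U P) := by
    refine MvPolynomial.derivation_ext fun i => ?_
    rw [Derivation.smul_apply, hV, mkDerivation_X, hz, smul_eq_mul]
  have hPV' : ∀ x, P * V x = jac x P (U P) := fun x => by
    rw [← jacDer_apply, ← hPV, Derivation.smul_apply, smul_eq_mul]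
  have hVP : V P = 0 := by
    have := hPV' P
    rw [hself] at this
    exact (mul_eq_zero.mp this).resolve_left hP0
  have hVQ : V (U P) = 0 := by
    have := hPV' (U P)
    rw [hself'] at this
    exact (mul_eq_zero.mp this).resolve_left hP0
  have hVg : V g = C σ := by
    have := hPV' g
    rw [jac_rotate, h1] at this
    refine mul_left_cancel₀ hP0 ?_
    rw [this, mul_comm]
  have hdiv : divergence V = 0 := by
    have := divergence_smul P V
    rw [hPV, divergence_jacDer, hVP, zero_add] at this
    exact (mul_eq_zero.mp this.symm).resolve_left hP0
  obtain ⟨a₀, a₁, a₂, ha₀, ha₁, ha₂⟩ := exists_curl_eq k hdiv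
  set η := oneForm a₀ a₁ a₂ with hη
  have hσ0 : (C σ : B₃(R)) ≠ 0 := by
    rw [Ne, C_eq_zero]
    exact hσ.ne_zero
  have hEU : E (U P) = 0 := by rw [h.e_u_eq hEP]; norm_num
  have hDU := h.d_u_eq hDP hEP
  have hDUU := h.d_u_u_eq hDP hEP
  push_cast at hEP hDU hDUU
  have hEW : E (U (U P)) = -2 * U (U P) := by rw [h.eu (U P), hEU, map_zero]; ring
  have hdet1 : detDer V D U = -2 * U P := by
    have := detDer_mul_jac V D U P (U P) g
    rw [h1, hVP, hVQ, hVg, hDP, hDU] at this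
    refine mul_right_cancel₀ (mul_ne_zero hσ0 hP0) ?_
    rw [this]
    ring
  have hdet2 : detDer V D E = -4 * P := by
    have := detDer_mul_jac V D E P (U P) g
    rw [h1, hVP, hVQ, hVg, hDP, hDU, hEP, hEU] at this
    refine mul_right_cancel₀ (mul_ne_zero hσ0 hP0) ?_
    rw [this]
    ring
  have e1 := oneForm_lie ha₀ ha₁ ha₂ D U
  have e2 := oneForm_lie ha₀ ha₁ ha₂ D E
  have e3 : 2 * P * η U = U P * η E + U (U P) * η D := by
    have h5 : ∀ x, 2 * P * U x = U P * E x + U (U P) * D x := fun x =>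
      congrArg (fun V : Derivation R B₃(R) B₃(R) => V x)
        (h.two_mul_smul_u hDP (by push_cast; exact hEP) hDg hUg htop)
    simp only [hη, oneForm]
    linear_combination a₀ * h5 (X 0) + a₁ * h5 (X 1) + a₂ * h5 (X 2)
  have e4 : η ⁅D, E⁆ = -2 * η D := by
    have h5 : ∀ x, ⁅D, E⁆ x = -2 * D x := fun x => by
      rw [Derivation.commutator_apply, h.ed]; ring
    simp only [hη, oneForm, h5]
    ring
  rw [← hη, hdet1, h.lie_d_u] at e1
  rw [← hη, hdet2, e4] at e2
  have h2f : 2 * (2 * P * U (U P) - U P ^ 2) ∈ exacts D U := by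
    have := add_mem (add_mem
      (map_d_mem_exacts (D := D) (U := U) (U P * η U - U (U P) * η E))
      (h.map_e_mem_exacts (U (U P) * η D)))
      (map_u_mem_exacts (D := D) (U := U) (-(U P * η D)))
    convert this using 1
    simp only [map_neg, map_sub, Derivation.leibniz, smul_eq_mul, hEW, hDU, hDUU]
    linear_combination -(U P) * e1 + U (U P) * e2 - e3
  have hf := h.discr_mem_invariants hDP (by push_cast; exact hEP)
  exact h.eq_zero_of_mem_exacts hf.1 hf.2
    (mem_exacts_of_intCast_mul k (n := 2) two_ne_zero (by simpa using h2f))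

end IsSl2Action

/-- A polynomial coprime to its derivative which is an eigenvector of a vector field on the line
is linear with invertible leading coefficient. -/
lemma Polynomial.exists_eq_linear (k : Type*) {R : Type*} [Field k] [CharZero k] [CommRing R]
    [Algebra k R] [IsDomain R] [CharZero R] {F Φ S T : Polynomial R} (hF' : F.derivative ≠ 0)
    (hΦ : F.derivative * Φ = 2 * (3 - Φ.derivative) * F) (hST : F.derivative * S + F * T = 1) :
    ∃ a b : R, IsUnit a ∧ F = Polynomial.C a * Polynomial.X + Polynomial.C b := by
  have hF0 : F ≠ 0 := by rintro rfl; simp at hF'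
  set d := F.natDegree with hd
  have hd0 : d ≠ 0 := by
    intro h0
    rw [Polynomial.eq_C_of_natDegree_eq_zero h0] at hF'
    simp at hF'
  have hlc : F.coeff d ≠ 0 := by
    rw [hd, Polynomial.coeff_natDegree]
    exact Polynomial.leadingCoeff_ne_zero.mpr hF0
  have he : Φ.natDegree ≤ 1 := by
    by_contra! he
    obtain ⟨e, he'⟩ : ∃ e, Φ.natDegree = e + 1 := ⟨Φ.natDegree - 1, by lia⟩
    obtain ⟨d', hd'⟩ : ∃ d', d = d' + 1 := ⟨d - 1, by lia⟩
    have hlc' : Φ.coeff (e + 1) ≠ 0 := by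
      rw [← he', Polynomial.coeff_natDegree]
      refine Polynomial.leadingCoeff_ne_zero.mpr ?_
      rintro rfl
      simp at he'
    have h1 : (F.derivative * Φ).coeff (d' + (e + 1)) = F.derivative.coeff d' * Φ.coeff (e + 1) :=
      Polynomial.coeff_mul_add_eq_of_natDegree_le
        ((Polynomial.natDegree_derivative_le F).trans (by lia)) he'.le
    have h2 : ((3 - Φ.derivative) * F).coeff (e + d) = (3 - Φ.derivative).coeff e * F.coeff d := by
      refine Polynomial.coeff_mul_add_eq_of_natDegree_le ?_ le_rfl
      refine (Polynomial.natDegree_sub_le _ _).trans (max_le (by simp) ?_)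
      exact (Polynomial.natDegree_derivative_le _).trans (by lia)
    have h3 : ((3 : Polynomial R)).coeff e = 0 := by
      rw [← Polynomial.C_ofNat, Polynomial.coeff_C, if_neg (by lia)]
    rw [hΦ, mul_assoc, ← Polynomial.C_ofNat 2, Polynomial.coeff_C_mul,
      show d' + (e + 1) = e + d by lia, h2, Polynomial.coeff_sub, h3, Polynomial.coeff_derivative,
      Polynomial.coeff_derivative, ← hd'] at h1
    have h4 : ((d' + 1 + 2 * (e + 1) : ℕ) : R) * (F.coeff d * Φ.coeff (e + 1)) = 0 := by
      push_cast
      linear_combination -h1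
    exact (mul_ne_zero (Nat.cast_ne_zero.mpr (by lia)) (mul_ne_zero hlc hlc')) h4
  obtain ⟨α, β, rfl⟩ := Polynomial.exists_eq_X_add_C_of_natDegree_le_one he
  have hder : (Polynomial.C α * Polynomial.X + Polynomial.C β).derivative = Polynomial.C α := by
    simp
  rw [hder] at hΦ
  have hα : α * (d + 2) = 6 := by
    have h1 := congrArg (fun G => Polynomial.coeff G d) hΦ
    obtain ⟨d', hd'⟩ : ∃ d', d = d' + 1 := ⟨d - 1, by lia⟩
    have h2 : F.derivative.coeff d = 0 := by
      rw [Polynomial.coeff_derivative, Polynomial.coeff_eq_zero_of_natDegree_lt (by lia), zero_mul]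
    have h3 : F.derivative.coeff d' = F.coeff d * d := by
      rw [Polynomial.coeff_derivative, hd']; push_cast; ring
    have h4 : (F.derivative * (Polynomial.C α * Polynomial.X + Polynomial.C β)).coeff d
        = F.coeff d * d * α := by
      rw [mul_add, ← mul_assoc, Polynomial.coeff_add, Polynomial.coeff_mul_C, h2, zero_mul, add_zero,
        hd', Polynomial.coeff_mul_X, Polynomial.coeff_mul_C, h3, hd']
    have h5 : (2 * (3 - Polynomial.C α) * F).coeff d = 2 * (3 - α) * F.coeff d := by
      rw [← Polynomial.coeff_C_mul, Polynomial.C_mul, Polynomial.C_sub, Polynomial.C_ofNat,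
        Polynomial.C_ofNat]
    have h6 := h4.symm.trans (h1.trans h5)
    refine mul_left_cancel₀ hlc ?_
    linear_combination h6
  have hdvd : F.derivative ∣ F := by
    have hk : ((6 * d : ℕ) : k) ≠ 0 := Nat.cast_ne_zero.mpr (by lia)
    refine ⟨Polynomial.C (algebraMap k R ((6 * d : ℕ) : k)⁻¹ * (d + 2))
      * (Polynomial.C α * Polynomial.X + Polynomial.C β), ?_⟩
    have h1 : (Polynomial.C (d : R) + 2) * Polynomial.C α = 6 := by
      rw [← Polynomial.C_ofNat 2, ← Polynomial.C_add, ← Polynomial.C_mul, mul_comm, hα,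
        Polynomial.C_ofNat]
    have h2 : Polynomial.C (algebraMap k R ((6 * d : ℕ) : k)⁻¹) * (6 * Polynomial.C (d : R)) = 1 := by
      rw [← Polynomial.C_ofNat 6, ← Polynomial.C_mul, ← Polynomial.C_mul]
      have : (OfNat.ofNat 6 * d : R) = algebraMap k R ((6 * d : ℕ) : k) := by
        rw [map_natCast]; push_cast; rfl
      rw [this, ← map_mul, inv_mul_cancel₀ hk, map_one, map_one]
    rw [Polynomial.C_mul, Polynomial.C_add, Polynomial.C_ofNat 2]
    set c := Polynomial.C (algebraMap k R ((6 * d : ℕ) : k)⁻¹)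
    linear_combination (-c * (Polynomial.C (d : R) + 2)) * hΦ - F * h2
      + 2 * c * F * h1
  have hu : IsUnit F.derivative := by
    refine isUnit_of_dvd_one ?_
    rw [← hST]
    exact dvd_add (dvd_mul_right _ _) (dvd_mul_of_dvd_left hdvd _)
  obtain ⟨a, ha, haF⟩ := Polynomial.isUnit_iff.mp hu
  have hd1 : F.natDegree ≤ 1 := by
    by_contra! hd1
    obtain ⟨d', hd'⟩ : ∃ d', d = d' + 1 := ⟨d - 1, by lia⟩
    have h3 : F.derivative.coeff d' = F.coeff (d' + 1) * (d' + 1) := Polynomial.coeff_derivative _ _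
    rw [← haF, Polynomial.coeff_C, if_neg (by lia), ← hd'] at h3
    refine (mul_ne_zero hlc ?_) h3.symm
    exact_mod_cast d'.succ_ne_zero
  obtain ⟨a', b, rfl⟩ := Polynomial.exists_eq_X_add_C_of_natDegree_le_one hd1
  refine ⟨a', b, ?_, rfl⟩
  simp at haF
  exact haF ▸ ha

namespace MvPolynomial

variable {R : Type*} [CommRing R]

lemma lie_smul_jacDer {Y : Derivation R B₃(R) B₃(R)} (hY : divergence Y = 0) (a b c : B₃(R)) :
    ⁅Y, a • jacDer b c⁆ = Y a • jacDer b c + a • jacDer (Y b) c + a • jacDer b (Y c) := by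
  refine Derivation.ext fun x => ?_
  have := derivation_jac Y x b c
  rw [hY] at this
  simp only [Derivation.commutator_apply, Derivation.add_apply, Derivation.smul_apply, smul_eq_mul,
    jacDer_apply, Derivation.leibniz]
  linear_combination a * this

lemma eq_sum_smul_jacDer (Z : Derivation R B₃(R) B₃(R)) :
    Z = Z (X 0) • jacDer (X 1) (X 2) + Z (X 1) • jacDer (X 2) (X 0)
      + Z (X 2) • jacDer (X 0) (X 1) := by
  refine MvPolynomial.derivation_ext fun i => ?_
  fin_cases i <;>
  simp [jacDer_apply, jac, pderiv_X]

end MvPolynomial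

namespace IsSl2Action

variable {k R : Type*} [Field k] [CharZero k] [CommRing R] [Algebra k R]
  [IsDomain R] [CharZero R]

variable {D U E : Derivation R B₃(R) B₃(R)}

/-- The bracket with a fixed derivation. -/
noncomputable def adj (k : Type*) {R : Type*} [Field k] [CommRing R] [Algebra k R]
    (Y : Derivation R B₃(R) B₃(R)) : Module.End k (Derivation R B₃(R) B₃(R)) where
  toFun Z := ⁅Y, Z⁆
  map_add' := lie_add Y
  map_smul' c Z := by
    refine Derivation.ext fun x => ?_
    have : ∀ y : B₃(R), Y (c • y) = c • Y y := (Y.toLinearMap.restrictScalars k).map_smul c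
    simp [Derivation.commutator_apply, this, smul_sub]

lemma adj_apply (Y Z : Derivation R B₃(R) B₃(R)) : adj k Y Z = ⁅Y, Z⁆ := rfl

lemma exists_adj_pow_eq_zero {Y : Derivation R B₃(R) B₃(R)} (hY : divergence Y = 0)
    (hnil : ∀ x, ∃ n : ℕ, Y^[n] x = 0) (Z : Derivation R B₃(R) B₃(R)) :
    ∃ n : ℕ, (adj k Y ^ n) Z = 0 := by
  have key : ∀ a b c : B₃(R), ∃ n : ℕ, (adj k Y ^ n) (a • jacDer b c) = 0 := by
    intro a b c
    obtain ⟨i, hi⟩ := hnil a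
    obtain ⟨j, hj⟩ := hnil b
    obtain ⟨l, hl⟩ := hnil c
    refine ⟨i + j + l, ?_⟩
    rw [Module.End.pow_apply]
    refine iterate_trilinear_eq_zero (Y : B₃(R) →ₗ[R] B₃(R)).toAddMonoidHom
      (adj k Y).toAddMonoidHom (fun a b c => a • jacDer b c) (by simp) ?_ ?_
      (fun a b c => lie_smul_jacDer hY a b c) _ i j l a b c le_rfl hi hj hl
    · intro a c; refine Derivation.ext fun x => ?_; simp [jacDer_apply, jac]
    · intro a c; refine Derivation.ext fun x => ?_; simp [jacDer_apply, jac]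
  have hadd : ∀ Z₁ Z₂, (∃ n : ℕ, (adj k Y ^ n) Z₁ = 0) → (∃ n : ℕ, (adj k Y ^ n) Z₂ = 0) →
      ∃ n : ℕ, (adj k Y ^ n) (Z₁ + Z₂) = 0 := by
    rintro Z₁ Z₂ ⟨m, hm⟩ ⟨n, hn⟩
    refine ⟨m + n, ?_⟩
    have h1 : (adj k Y ^ (m + n)) Z₁ = 0 := by
      rw [add_comm, pow_add, Module.End.mul_apply, hm, map_zero]
    have h2 : (adj k Y ^ (m + n)) Z₂ = 0 := by
      rw [pow_add, Module.End.mul_apply, hn, map_zero]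
    rw [map_add, h1, h2, add_zero]
  rw [eq_sum_smul_jacDer Z]
  exact hadd _ _ (hadd _ _ (key _ _ _) (key _ _ _)) (key _ _ _)

lemma isIntegrableSl2_adj (h : IsSl2Action k D U E) :
    IsIntegrableSl2 (adj k D) (adj k U) (adj k E) where
  du Z := by
    simp only [adj_apply]
    rw [← h.lie_d_u]
    refine Derivation.ext fun x => ?_
    simp only [Derivation.commutator_apply, Derivation.add_apply, map_sub]
    ring
  ed Z := by
    simp only [adj_apply]
    refine Derivation.ext fun x => ?_
    have := h.ed
    simp only [Derivation.commutator_apply, map_sub, Derivation.add_apply, Derivation.smul_apply,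
      h.ed, map_add, two_smul, Derivation.leibniz, two_mul]
    ring
  eu Z := by
    simp only [adj_apply]
    refine Derivation.ext fun x => ?_
    simp only [Derivation.commutator_apply, map_sub, Derivation.sub_apply, Derivation.add_apply,
      h.eu, map_add, two_smul, Derivation.leibniz, two_mul]
    ring
  dnil Z := exists_adj_pow_eq_zero h.divergence_d h.lnd_d Z
  unil Z := exists_adj_pow_eq_zero h.divergence_u h.lnd_u Z
  span Z := by
    set S := Submodule.span k {Y | ∃ i : ℤ, adj k E Y = (i : k) • Y} with hS
    have hweight : ∀ (i j l : ℤ) (a b c : B₃(R)), E a = i * a → E b = j * b → E c = l * c →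
        a • jacDer b c ∈ S := by
      intro i j l a b c ha hb hc
      refine Submodule.subset_span ⟨i + j + l, ?_⟩
      rw [adj_apply, lie_smul_jacDer h.divergence_e, ha, hb, hc]
      refine Derivation.ext fun x => ?_
      have hz : ∀ (n : ℤ) (i : Fin 3), pderiv i (n : B₃(R)) = 0 :=
        fun n i => (pderiv i).map_intCast n
      simp only [Derivation.add_apply, Derivation.smul_apply, intCast_smul, jacDer_apply, jac,
        Derivation.leibniz, hz, smul_eq_mul]
      push_cast
      ring
    have hspan : ∀ {p : B₃(R) → Prop}, (∀ (i : ℤ) b, E b = i * b → p b) →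
        (∀ b c, p b → p c → p (b + c)) → p 0 → (∀ (r : k) b, p b → p (r • b)) → ∀ b, p b := by
      intro p h1 h2 h3 h4 b
      have := IsIntegrableSl2.span h b
      induction this using Submodule.span_induction with
      | mem x hx =>
        obtain ⟨i, hi⟩ := hx
        refine h1 i x ?_
        rw [← intCast_smul (k := k)]
        exact hi
      | zero => exact h3
      | add x y _ _ hx hy => exact h2 _ _ hx hy
      | smul r x _ hx => exact h4 _ _ hx
    have hk : ∀ (r : k) (b : B₃(R)) (i : Fin 3), pderiv i (r • b) = r • pderiv i b :=
      fun r b i => ((pderiv i).toLinearMap.restrictScalars k).map_smul r b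
    have hall : ∀ a b c : B₃(R), a • jacDer b c ∈ S := by
      intro a b c
      revert a b c
      refine hspan (fun i a ha => ?_) (fun a a' ha ha' b c => ?_) (fun b c => ?_)
        (fun r a ha b c => ?_)
      · refine hspan (fun j b hb => ?_) (fun b b' hb hb' c => ?_) (fun c => ?_) (fun r b hb c => ?_)
        · refine hspan (fun l c hc => ?_) (fun c c' hc hc' => ?_) ?_ (fun r c hc => ?_)
          · exact hweight i j l a b c ha hb hc
          · convert add_mem hc hc' using 1
            refine Derivation.ext fun x => ?_; simp [jacDer_apply, jac]; ring
          · convert zero_mem S using 1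
            refine Derivation.ext fun x => ?_; simp [jacDer_apply, jac]
          · convert S.smul_mem r hc using 1
            refine Derivation.ext fun x => ?_
            simp only [Derivation.smul_apply, jacDer_apply, jac, hk, mul_smul_comm, smul_mul_assoc,
              ← smul_sub, ← smul_add, smul_eq_mul]
        · convert add_mem (hb c) (hb' c) using 1
          refine Derivation.ext fun x => ?_; simp [jacDer_apply, jac]; ring
        · convert zero_mem S using 1
          refine Derivation.ext fun x => ?_; simp [jacDer_apply, jac]
        · convert S.smul_mem r (hb c) using 1
          refine Derivation.ext fun x => ?_
          simp only [Derivation.smul_apply, jacDer_apply, jac, hk, mul_smul_comm, smul_mul_assoc,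
              ← smul_sub, ← smul_add, smul_eq_mul]
      · rw [add_smul]; exact add_mem (ha b c) (ha' b c)
      · rw [zero_smul]; exact zero_mem S
      · rw [smul_assoc]; exact S.smul_mem r (ha b c)
    rw [eq_sum_smul_jacDer Z]
    exact add_mem (add_mem (hall _ _ _) (hall _ _ _)) (hall _ _ _)

/-- There is an equivariant derivation of constant nonzero divergence. -/
lemma exists_commuting (h : IsSl2Action k D U E) :
    ∃ V : Derivation R B₃(R) B₃(R), (∀ x, V (D x) = D (V x)) ∧ (∀ x, V (U x) = U (V x)) ∧
      divergence V = 3 := by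
  obtain ⟨V, hD, hU, hV⟩ := h.isIntegrableSl2_adj.exists_invariant euler
  rw [adj_apply] at hD hU
  obtain ⟨_, ⟨Y, rfl⟩, _, ⟨Z, rfl⟩, hYZ⟩ := Submodule.mem_sup.mp hV
  rw [adj_apply, adj_apply] at hYZ
  have hcomm : ∀ W : Derivation R B₃(R) B₃(R), ⁅W, V⁆ = 0 → ∀ x, V (W x) = W (V x) := by
    intro W hW x
    have := congrArg (fun T : Derivation R B₃(R) B₃(R) => T x) hW
    simp only [Derivation.commutator_apply, Derivation.zero_apply] at this
    exact (sub_eq_zero.mp this).symm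
  have h0 : divergence (0 : Derivation R B₃(R) B₃(R)) = 0 := by simp [divergence]
  have hDV : D (divergence V) = 0 := by
    have := divergence_lie D V
    rw [hD, h.divergence_d, map_zero, sub_zero, h0] at this
    exact this.symm
  have hUV : U (divergence V) = 0 := by
    have := divergence_lie U V
    rw [hU, h.divergence_u, map_zero, sub_zero, h0] at this
    exact this.symm
  have h1 := congrArg divergence hYZ
  rw [divergence_add, divergence_lie, divergence_lie, h.divergence_d, h.divergence_u, map_zero,
    map_zero, sub_zero, sub_zero, divergence_sub, divergence_euler] at h1
  refine ⟨V, hcomm D hD, hcomm U hU, ?_⟩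
  have h3 : ∀ W : Derivation R B₃(R) B₃(R), W (3 : B₃(R)) = 0 := fun W => W.map_natCast 3
  have := h.eq_zero_of_mem_range (y := 3 - divergence V) (by rw [map_sub, h3, hDV, sub_zero])
    (by rw [map_sub, h3, hUV, sub_zero]) h1.symm
  exact (sub_eq_zero.mp this).symm

/-- In the case of the adjoint action the discriminant is a coordinate on the quotient. -/
lemma exists_discr_eq_linear (h : IsSl2Action k D U E) {P g : B₃(R)}
    (hDP : D P = 0) (hEP : E P = (2 : ℕ) * P) (hP0 : P ≠ 0)
    (hfac : ∀ (a : B₃(R)) (n : ℕ), a ≠ 0 → D a = 0 → E a = n * a →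
      ∃ (s : B₃(R)) (j : ℕ), D s = 0 ∧ U s = 0 ∧ a = s * P ^ j ∧ j * 2 = n)
    (hDg : D g = 0) (hUg : U g = 0) (hg : Transcendental R g)
    (hS : ∀ q, D q = 0 → U q = 0 → ∃ F : Polynomial R, q = Polynomial.aeval g F)
    (htop : Algebra.adjoin R {P, U P, U (U P), g} = ⊤) :
    ∃ a b : R, IsUnit a ∧ 2 * P * U (U P) - U P ^ 2 = C a * g + C b := by
  obtain ⟨hfD, hfU⟩ := h.discr_mem_invariants hDP hEP
  obtain ⟨F, hF⟩ := hS _ hfD hfU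
  obtain ⟨V, hVD, hVU, hV⟩ := h.exists_commuting
  have hVE : ∀ x, V (E x) = E (V x) := by
    intro x
    have h1 := h.du x
    have h2 := h.du (V x)
    have h3 := congrArg V h1
    rw [map_add, hVD, hVU, hVU, hVD, h2] at h3
    exact (add_left_cancel h3).symm
  obtain ⟨Φ, hΦ⟩ := hS (V g) (by rw [← hVD, hDg, map_zero]) (by rw [← hVU, hUg, map_zero])
  obtain ⟨Ψ, hΨ⟩ : ∃ Ψ : Polynomial R, V P = Polynomial.aeval g Ψ * P := by
    by_cases h0 : V P = 0
    · exact ⟨0, by simp [h0]⟩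
    · obtain ⟨s, j, h1, h2, h3, h4⟩ := hfac (V P) 2 h0 (by rw [← hVD, hDP, map_zero]) (by
        rw [← hVE, hEP, Derivation.leibniz, Derivation.map_natCast]
        simp)
      obtain ⟨Ψ, rfl⟩ := hS s h1 h2
      obtain rfl : j = 1 := by lia
      exact ⟨Ψ, by rw [h3, pow_one]⟩
  have hinv : ∀ G : Polynomial R, U (Polynomial.aeval g G) = 0 := fun G => by
    rw [Derivation.map_aeval, hUg, smul_zero]
  have hVQ : V (U P) = Polynomial.aeval g Ψ * U P := by
    rw [hVU, hΨ, Derivation.leibniz, hinv]; simp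
  have hVW : V (U (U P)) = Polynomial.aeval g Ψ * U (U P) := by
    rw [hVU, hVQ, Derivation.leibniz, hinv]; simp
  obtain ⟨σ, hσ, h1, -, -, -⟩ := h.exists_jac_eq hDP hEP hP0 hfac hDg hUg htop hF
  have hσ0 : (C σ : B₃(R)) ≠ 0 := by
    rw [Ne, C_eq_zero]
    exact hσ.ne_zero
  have e1 : Polynomial.aeval g F.derivative * Polynomial.aeval g Φ
      = 2 * Polynomial.aeval g Ψ * Polynomial.aeval g F := by
    have := congrArg V hF
    rw [Derivation.map_aeval, smul_eq_mul, hΦ] at this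
    rw [← this, ← hF, map_sub, Derivation.leibniz, Derivation.leibniz, Derivation.leibniz_pow, hVW,
      hVQ, hΨ, show V (2 : B₃(R)) = 0 from V.map_natCast 2]
    simp only [smul_eq_mul, nsmul_eq_mul]
    push_cast
    ring
  have e2 : Polynomial.aeval g Ψ + Polynomial.aeval g Φ.derivative = (3 : B₃(R)) := by
    have := derivation_jac V P (U P) g
    have hp : ∀ (i : Fin 3) (G : Polynomial R),
        pderiv i (Polynomial.aeval g G) = Polynomial.aeval g G.derivative * pderiv i g :=
      fun i G => Derivation.map_aeval _ _ _
    have h2 : jac (V P) (U P) g = Polynomial.aeval g Ψ * jac P (U P) g := by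
      rw [hΨ]; simp only [jac, Derivation.leibniz, hp, smul_eq_mul]; ring
    have h3 : jac P (V (U P)) g = Polynomial.aeval g Ψ * jac P (U P) g := by
      rw [hVQ]; simp only [jac, Derivation.leibniz, hp, smul_eq_mul]; ring
    have h4 : jac P (U P) (V g) = Polynomial.aeval g Φ.derivative * jac P (U P) g := by
      rw [hΦ]; simp only [jac, hp]; ring
    rw [h2, h3, h4, hV, h1, Derivation.leibniz, hΨ,
      show V (C σ) = 0 from V.map_algebraMap σ] at this
    simp only [smul_eq_mul, mul_zero, add_zero] at this
    refine mul_right_cancel₀ (mul_ne_zero hσ0 hP0) ?_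
    linear_combination -this
  have hinj : ∀ G H : Polynomial R, Polynomial.aeval g G = Polynomial.aeval g H → G = H :=
    fun G H hGH => transcendental_iff_injective.mp hg hGH
  have e3 : Ψ = 3 - Φ.derivative := by
    refine hinj _ _ ?_
    rw [map_sub, map_ofNat, ← e2]
    ring
  have e4 : F.derivative * Φ = 2 * (3 - Φ.derivative) * F := by
    refine hinj _ _ ?_
    rw [← e3, map_mul, map_mul, map_mul, map_ofNat, e1]
  obtain ⟨S, T, hST⟩ := h.exists_bezout hDP hEP hP0 hfac hDg hUg hg hS htop hF
  obtain ⟨a, b, ha, rfl⟩ := Polynomial.exists_eq_linear k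
    (h.derivative_ne_zero hDP hEP hP0 hfac hDg hUg hg hS htop hF) e4 hST
  refine ⟨a, b, ha, ?_⟩
  rw [hF]
  simp [MvPolynomial.algebraMap_eq]

end IsSl2Action

lemma RingHom.injective_of_surjective_of_isNoetherianRing {A : Type*} [CommRing A]
    [IsNoetherianRing A] (f : A →+* A) (hf : Function.Surjective f) : Function.Injective f := by
  have hmono : Monotone fun n : ℕ => RingHom.ker (f ^ n) := by
    refine monotone_nat_of_le_succ fun n x hx => ?_
    rw [RingHom.mem_ker] at hx ⊢
    rw [pow_succ', RingHom.mul_def, RingHom.comp_apply, hx, map_zero]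
  obtain ⟨n, hn⟩ := monotone_stabilizes_iff_noetherian.mpr ‹_› ⟨_, hmono⟩
  have hn' : RingHom.ker (f ^ n) = RingHom.ker (f ^ (n + 1)) := hn (n + 1) n.le_succ
  have hsurj : Function.Surjective (f ^ n) := by
    rw [RingHom.coe_pow]
    exact hf.iterate n
  refine (injective_iff_map_eq_zero f).mpr fun x hx => ?_
  obtain ⟨y, rfl⟩ := hsurj x
  have hy : y ∈ RingHom.ker (f ^ (n + 1)) := by
    rw [RingHom.mem_ker, pow_succ', RingHom.mul_def, RingHom.comp_apply, hx]
  rw [← hn'] at hy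
  exact hy

lemma exists_algEquiv_of_adjoin_eq_top {R : Type*} [CommRing R] [IsNoetherianRing R]
    {p q r : B₃(R)} (hp : Algebra.adjoin R {p, q, r} = ⊤) :
    ∃ θ : B₃(R) ≃ₐ[R] B₃(R), θ (X 0) = p ∧ θ (X 1) = q ∧ θ (X 2) = r := by
  have hr : Set.range ![p, q, r] = {p, q, r} := by
    simp only [Matrix.range_cons, Matrix.range_empty, Set.union_empty, Set.singleton_union]
  have hsurj : Function.Surjective (aeval ![p, q, r] : B₃(R) →ₐ[R] B₃(R)) := by
    rw [← AlgHom.range_eq_top, ← Algebra.adjoin_range_eq_range_aeval, hr, hp]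
  have hinj := (aeval ![p, q, r] : B₃(R) →ₐ[R] B₃(R)).toRingHom
    |>.injective_of_surjective_of_isNoetherianRing hsurj
  exact ⟨AlgEquiv.ofBijective (aeval ![p, q, r]) ⟨hinj, hsurj⟩, aeval_X _ _, aeval_X _ _,
    aeval_X _ _⟩

lemma equivPair_of_algEquiv {R : Type*} [CommRing R] {D U D' U' : Derivation R B₃(R) B₃(R)}
    (θ : B₃(R) ≃ₐ[R] B₃(R)) (hD : ∀ i, D (θ (X i)) = θ (D' (X i)))
    (hU : ∀ i, U (θ (X i)) = θ (U' (X i))) : EquivPair D U D' U' := by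
  have key : ∀ Y Y' : Derivation R B₃(R) B₃(R), (∀ i, Y (θ (X i)) = θ (Y' (X i))) →
      ∀ b, θ.symm (Y b) = Y' (θ.symm b) := by
    intro Y Y' h b
    suffices h : ∀ c, Y (θ c) = θ (Y' c) by
      rw [AlgEquiv.symm_apply_eq, ← h, AlgEquiv.apply_symm_apply]
    intro c
    induction c using MvPolynomial.induction_on with
    | C r =>
      rw [← MvPolynomial.algebraMap_eq, AlgEquiv.commutes, Derivation.map_algebraMap,
        Derivation.map_algebraMap, map_zero]
    | add p q hp hq => simp only [map_add, hp, hq]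
    | mul_X p i hp => simp only [map_mul, map_add, Derivation.leibniz, smul_eq_mul, hp, h]
  refine ⟨θ.symm, 1, Or.inl ⟨fun b => ?_, fun b => ?_⟩⟩
  · rw [Units.val_one, one_smul, key D D' hD]
  · rw [inv_one, Units.val_one, one_smul, key U U' hU]

lemma IsFundamentalPair.isSl2Action {k R : Type*} [Field k] [CommRing R] [Algebra k R]
    {D U : Derivation R B₃(R) B₃(R)} (h : IsFundamentalPair D U) : IsSl2Action k D U ⁅D, U⁆ := by
  obtain ⟨hD, hU, hDE, hUE, hspan⟩ := h
  have hpow : ∀ (Y : Derivation R B₃(R) B₃(R)) (n : ℕ) (b : B₃(R)),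
      ((Y.toLinearMap.restrictScalars k) ^ n) b = (Y.toLinearMap ^ n) b := fun Y n b => by
    rw [Module.End.pow_apply, Module.End.pow_apply]; rfl
  refine ⟨fun x => ?_, fun x => ?_, fun x => ?_, fun x => ?_, fun x => ?_, fun x => ?_⟩
  · change D (U x) = U (D x) + ⁅D, U⁆ x
    rw [Derivation.commutator_apply]; ring
  · change ⁅D, U⁆ (D x) = D (⁅D, U⁆ x) + (2 : k) • D x
    have := congrArg (fun Y : Derivation R B₃(R) B₃(R) => Y x) hDE
    rw [Derivation.commutator_apply (D1 := D) (D2 := ⁅D, U⁆)] at this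
    rw [two_smul]
    simp only [Derivation.smul_apply, neg_smul, two_smul, Derivation.neg_apply,
      Derivation.add_apply] at this
    linear_combination -this
  · change ⁅D, U⁆ (U x) = U (⁅D, U⁆ x) - (2 : k) • U x
    have := congrArg (fun Y : Derivation R B₃(R) B₃(R) => Y x) hUE
    rw [Derivation.commutator_apply (D1 := U) (D2 := ⁅D, U⁆)] at this
    rw [two_smul]
    simp only [two_smul, Derivation.add_apply] at this
    linear_combination -this
  · obtain ⟨n, hn⟩ := hD x
    exact ⟨n, (hpow D n x).trans hn⟩
  · obtain ⟨n, hn⟩ := hU x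
    exact ⟨n, (hpow U n x).trans hn⟩
  · have hx : x ∈ ⨆ d : ℤ, gradePiece D U d := hspan ▸ Submodule.mem_top
    induction hx using Submodule.iSup_induction' with
    | mem i y hy =>
      refine Submodule.subset_span ⟨i, ?_⟩
      have hy' : ⁅D, U⁆ y - i • y = 0 := hy
      rw [Int.cast_smul_eq_zsmul]
      exact sub_eq_zero.mp hy'
    | zero => exact zero_mem _
    | add y z _ _ hy hz => exact add_mem hy hz

lemma IsFundamentalPair.ne_zero {k R : Type*} [Field k] [CharZero k] [CommRing R] [Algebra k R]
    {D U : Derivation R B₃(R) B₃(R)} (h : IsFundamentalPair D U) (hnt : ¬(D = 0 ∧ U = 0)) :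
    D ≠ 0 := by
  rintro rfl
  refine hnt ⟨rfl, ?_⟩
  have h1 := h.2.2.2.1
  refine Derivation.ext fun x => ?_
  have h2 : (2 : k) • U x = 0 := by
    have := congrArg (fun Y : Derivation R B₃(R) B₃(R) => Y x) h1
    simp only [Derivation.commutator_apply, Derivation.add_apply, two_smul, Derivation.zero_apply,
      map_zero, sub_zero] at this
    rw [two_smul, ← this]
  rw [Derivation.zero_apply]
  exact (smul_eq_zero.mp h2).resolve_left two_ne_zero

/-- for an affine UFD `R` over `k` and `B = R[x₀,x₁,x₂]`, every nontrivial
fundamental pair of locally nilpotent `R`-derivations of `B` is equivalent over `R` to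
`(x₀∂_{x₁}, x₁∂_{x₀})` or to `(x₀∂_{x₁} + x₁∂_{x₂}, 2x₁∂_{x₀} + 2x₂∂_{x₁})`. -/
theorem stmt_18 {k R : Type*} [Field k] [CharZero k] [CommRing R] [IsDomain R]
    [UniqueFactorizationMonoid R] [Algebra k R] [Algebra.FiniteType k R]
    (D U : Derivation R (MvPolynomial (Fin 3) R) (MvPolynomial (Fin 3) R))
    (hDU : IsFundamentalPair D U) (hnt : ¬(D = 0 ∧ U = 0)) :
    EquivPair D U (mkDerivation R ![0, X 0, 0]) (mkDerivation R ![X 1, 0, 0]) ∨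
    EquivPair D U (mkDerivation R ![0, X 0, X 1])
      (mkDerivation R ![2 * X 1, 2 * X 2, 0]) := by
  have : CharZero R := charZero_of_injective_algebraMap (algebraMap k R).injective
  have : IsNoetherianRing R := Algebra.FiniteType.isNoetherianRing k R
  have h : IsSl2Action k D U ⁅D, U⁆ := hDU.isSl2Action
  obtain ⟨P, g, m, hm, hP0, hDP, hEP, -, hfac, hDg, hUg, hg, hS, htop⟩ :=
    h.exists_structure (hDU.ne_zero (k := k) hnt)
  have hDQ := h.d_u_eq hDP hEP
  rcases hm with rfl | rfl
  · left
    have hUU : U (U P) = 0 := 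
      h.iterate_u_eq_zero (c := 1) hDP (by rw [hEP])
    have htop' : Algebra.adjoin R {P, U P, g} = ⊤ := by
      rw [← top_le_iff, ← htop]
      refine Algebra.adjoin_le ?_
      intro x hx
      simp only [Set.mem_insert_iff, Set.mem_singleton_iff] at hx
      obtain hx | hx | hx | hx := hx
      · exact Algebra.subset_adjoin (by simp [hx])
      · exact Algebra.subset_adjoin (by simp [hx])
      · rw [hx, hUU]; exact zero_mem _
      · exact Algebra.subset_adjoin (by simp [hx])
    obtain ⟨θ, hθ0, hθ1, hθ2⟩ := exists_algEquiv_of_adjoin_eq_top htop'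
    refine equivPair_of_algEquiv θ (fun i => ?_) (fun i => ?_)
    · rw [mkDerivation_X]
      fin_cases i <;> simp [hθ0, hθ1, hθ2, hDP, hDQ, hDg]
    · rw [mkDerivation_X]
      fin_cases i <;> simp [hθ0, hθ1, hθ2, hUU, hUg]
  · right
    have hW := h.d_u_u_eq hDP hEP
    have hWU := h.u_u_u_eq_zero (Or.inr rfl) hDP hEP
    obtain ⟨a, b, ha, hab⟩ := h.exists_discr_eq_linear hDP hEP hP0 hfac hDg hUg hg hS htop
    obtain ⟨c, hc⟩ : ∃ c : R, 2 * c = 1 := ⟨algebraMap k R 2⁻¹, by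
      rw [← map_ofNat (algebraMap k R) 2, ← map_mul, mul_inv_cancel₀ two_ne_zero, map_one]⟩
    have hc' : 2 * C c = (1 : B₃(R)) := by
      rw [← map_ofNat (C : R →+* B₃(R)) 2, ← map_mul, hc, map_one]
    have hC : ∀ (r : R) (Y : Derivation R B₃(R) B₃(R)) (x : B₃(R)), Y (C r * x) = C r * Y x := by
      intro r Y x
      rw [← smul_eq_C_mul, Derivation.map_smul, smul_eq_C_mul]
    set A := Algebra.adjoin R {P, C c * U P, C (c ^ 2) * U (U P)} with hA
    have hCA : ∀ r : R, C r ∈ A := fun r => A.algebraMap_mem r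
    have h0 : P ∈ A := Algebra.subset_adjoin (by simp)
    have h1 : C c * U P ∈ A := Algebra.subset_adjoin (by simp)
    have h2 : C (c ^ 2) * U (U P) ∈ A := Algebra.subset_adjoin (by simp)
    have h1' : U P ∈ A := by
      convert mul_mem (hCA 2) h1 using 1
      rw [map_ofNat]
      linear_combination (-U P) * hc'
    have h2' : U (U P) ∈ A := by
      convert mul_mem (hCA 4) h2 using 1
      rw [map_ofNat, map_pow]
      linear_combination (-U (U P)) * (2 * C c + 1) * hc'
    have h3 : g ∈ A := by
      obtain ⟨a', ha'⟩ := ha.exists_left_inv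
      have ha'' : C a' * C a = (1 : B₃(R)) := by rw [← map_mul, ha', map_one]
      have : g = C a' * (C 2 * P * U (U P) - U P ^ 2 - C b) := by
        rw [map_ofNat, hab]
        linear_combination (-g) * ha''
      rw [this]
      exact mul_mem (hCA _) (sub_mem (sub_mem (mul_mem (mul_mem (hCA _) h0) h2') (pow_mem h1' 2))
        (hCA _))
    have hA' : A = ⊤ := by
      rw [← top_le_iff, ← htop]
      refine Algebra.adjoin_le ?_
      intro x hx
      simp only [Set.mem_insert_iff, Set.mem_singleton_iff] at hx
      obtain rfl | rfl | rfl | rfl := hx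
      exacts [h0, h1', h2', h3]
    obtain ⟨θ, hθ0, hθ1, hθ2⟩ := exists_algEquiv_of_adjoin_eq_top hA'
    push_cast at hDQ hW
    have hθC : θ 2 = 2 := map_ofNat θ 2
    refine equivPair_of_algEquiv θ (fun i => ?_) (fun i => ?_)
    · rw [mkDerivation_X]
      fin_cases i
      · simp [hθ0, hDP]
      · simp only [Fin.mk_one, Matrix.cons_val, hθ0, hθ1, hC, hDQ]
        linear_combination P * hc'
      · simp only [Fin.reduceFinMk, Matrix.cons_val, hθ1, hθ2, hC, hW]
        rw [map_pow]
        linear_combination C c * U P * hc'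
    · rw [mkDerivation_X]
      fin_cases i
      · simp only [Fin.zero_eta, Matrix.cons_val, hθ0, hθ1, map_mul, hθC]
        linear_combination (-U P) * hc'
      · simp only [Fin.mk_one, Matrix.cons_val, hθ1, hθ2, hC, map_mul, hθC, map_pow]
        linear_combination (-C c * U (U P)) * hc'
      · simp only [Fin.reduceFinMk, Matrix.cons_val, hθ2, hC, hWU, map_zero, mul_zero]
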